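/- arXiv:2105.11930 — 2 statements merged into one kernel-verified Lean document; each statement's English description precedes it below -/
import Mathlib

section
/- Let r(θ,t) be a smooth, 2π-periodic-in-θ solution on [0,2π] × [0,ω) of the equation ∂r/∂t = (1/g²)∂²r/∂θ² − (2/(r g²))(∂r/∂θ)² − r/g² + 2πg/(rL), with g = √(r² + (∂r/∂θ)²) and L(t) = ∫₀^{2π} g dθ, arising from Gage's area-preserving flow with a star-shaped initial curve of length L₀. If r(θ,t) ≥ c > 0 for all (θ,t) ∈ [0,2π] × [0,ω), then for all (θ,t): r(θ,t) ≤ L₀/2 and |∂r/∂θ(θ,t)| ≤ C₁, where C₁ = max{ max_θ |∂r/∂θ(θ,0)|, 3L₀/π } depends only on the initial curve. -/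
open Real Set MeasureTheory Filter

noncomputable section
/-- First partial derivative in `θ` of a radial function `r(θ, t)`. -/
def rdθ (r : ℝ → ℝ → ℝ) (θ t : ℝ) : ℝ := deriv (fun u => r u t) θ

/-- Second partial derivative in `θ` of a radial function `r(θ, t)`. -/
def rdθθ (r : ℝ → ℝ → ℝ) (θ t : ℝ) : ℝ := deriv (deriv (fun u => r u t)) θ

/-- The metric `g = √(r² + (∂r/∂θ)²)` of the polar curve with radial function `r`. -/
def rmet (r : ℝ → ℝ → ℝ) (θ t : ℝ) : ℝ := Real.sqrt (r θ t ^ 2 + rdθ r θ t ^ 2)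

/-- The length `L(t) = ∫₀^{2π} g dθ` of the polar curve with radial function `r`. -/
def rlen (r : ℝ → ℝ → ℝ) (t : ℝ) : ℝ := ∫ θ in (0:ℝ)..(2 * π), rmet r θ t

/-- The radial equation of Gage's area-preserving flow
`∂r/∂t = (1/g²) ∂²r/∂θ² − (2/(r g²)) (∂r/∂θ)² − r/g² + 2πg/(rL)` on the time set `I`. -/
def RadialGAPF (r : ℝ → ℝ → ℝ) (I : Set ℝ) : Prop :=
  ∀ t ∈ I, ∀ θ : ℝ,
    HasDerivWithinAt (fun τ => r θ τ)
      (rdθθ r θ t / rmet r θ t ^ 2 - 2 / (r θ t * rmet r θ t ^ 2) * rdθ r θ t ^ 2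
        - r θ t / rmet r θ t ^ 2 + 2 * π * rmet r θ t / (r θ t * rlen r t)) I t

/-- The radial equation of the curve shortening flow
`∂ρ/∂t = (1/g²) ∂²ρ/∂θ² − (2/(ρ g²)) (∂ρ/∂θ)² − ρ/g²` on the time set `I`. -/
def RadialCSF (ρ : ℝ → ℝ → ℝ) (I : Set ℝ) : Prop :=
  ∀ t ∈ I, ∀ θ : ℝ,
    HasDerivWithinAt (fun τ => ρ θ τ)
      (rdθθ ρ θ t / rmet ρ θ t ^ 2 - 2 / (ρ θ t * rmet ρ θ t ^ 2) * rdθ ρ θ t ^ 2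
        - ρ θ t / rmet ρ θ t ^ 2) I t

/-! ### Two-variable calculus on the space-time strip -/

/-- The strip `ℝ × [0, ω)`. -/
def strip (ω : ℝ) : Set (ℝ × ℝ) := Set.univ ×ˢ Set.Ico 0 ω

lemma strip_unique (ω : ℝ) : UniqueDiffOn ℝ (strip ω) :=
  uniqueDiffOn_univ.prod (uniqueDiffOn_Ico 0 ω)

lemma strip_nhds {ω t : ℝ} (ht : t ∈ Set.Ioo 0 ω) (θ : ℝ) : strip ω ∈ nhds (θ, t) :=
  prod_mem_nhds univ_mem (Ico_mem_nhds ht.1 ht.2)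

lemma space_hasDerivAt {G : ℝ × ℝ → ℝ} {ω t : ℝ} (hG : ContDiffOn ℝ (⊤ : ℕ∞) G (strip ω))
    (ht : t ∈ Set.Ico 0 ω) (θ : ℝ) :
    HasDerivAt (fun u => G (u, t)) (fderivWithin ℝ G (strip ω) (θ, t) (1, 0)) θ := by
  have h1 : HasFDerivWithinAt G (fderivWithin ℝ G (strip ω) (θ, t)) (strip ω) (θ, t) :=
    ((hG.differentiableOn (by simp)) (θ, t) ⟨mem_univ _, ht⟩).hasFDerivWithinAt
  have h2 : HasDerivWithinAt (fun u : ℝ => (u, t)) ((1 : ℝ), (0 : ℝ)) Set.univ θ :=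
    ((hasDerivAt_id θ).prodMk (hasDerivAt_const θ t)).hasDerivWithinAt
  have := h1.comp_hasDerivWithinAt θ h2 (fun u _ => by exact ⟨mem_univ _, ht⟩)
  exact hasDerivWithinAt_univ.1 this

lemma time_hasDerivAt {G : ℝ × ℝ → ℝ} {ω t : ℝ} (hG : ContDiffOn ℝ (⊤ : ℕ∞) G (strip ω))
    (ht : t ∈ Set.Ioo 0 ω) (θ : ℝ) :
    HasDerivAt (fun τ => G (θ, τ)) (fderivWithin ℝ G (strip ω) (θ, t) (0, 1)) t := by
  have h1 : HasFDerivAt G (fderivWithin ℝ G (strip ω) (θ, t)) (θ, t) :=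
    ((hG.differentiableOn (by simp)) (θ, t)
      ⟨mem_univ _, Ioo_subset_Ico_self ht⟩).hasFDerivWithinAt.hasFDerivAt (strip_nhds ht θ)
  have h2 : HasDerivAt (fun τ : ℝ => (θ, τ)) ((0 : ℝ), (1 : ℝ)) t :=
    (hasDerivAt_const t θ).prodMk (hasDerivAt_id t)
  exact h1.comp_hasDerivAt t h2

lemma dir_contDiffOn {G : ℝ × ℝ → ℝ} {ω : ℝ} (hG : ContDiffOn ℝ (⊤ : ℕ∞) G (strip ω))
    (v : ℝ × ℝ) :
    ContDiffOn ℝ (⊤ : ℕ∞) (fun x => fderivWithin ℝ G (strip ω) x v) (strip ω) := by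
  have := hG.fderivWithin (m := (⊤ : ℕ∞)) (strip_unique ω) (by simp)
  exact this.clm_apply contDiffOn_const

lemma rdθ_hasDerivAt {r : ℝ → ℝ → ℝ} {ω t : ℝ}
    (hr : ContDiffOn ℝ (⊤ : ℕ∞) (fun p : ℝ × ℝ => r p.1 p.2) (strip ω))
    (ht : t ∈ Set.Ico 0 ω) (θ : ℝ) :
    HasDerivAt (fun u => r u t) (rdθ r θ t) θ :=
  (space_hasDerivAt hr ht θ).differentiableAt.hasDerivAt

lemma rdθ_contDiffOn {r : ℝ → ℝ → ℝ} {ω : ℝ}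
    (hr : ContDiffOn ℝ (⊤ : ℕ∞) (fun p : ℝ × ℝ => r p.1 p.2) (strip ω)) :
    ContDiffOn ℝ (⊤ : ℕ∞) (fun p : ℝ × ℝ => rdθ r p.1 p.2) (strip ω) := by
  refine (dir_contDiffOn hr (1, 0)).congr ?_
  rintro ⟨θ, t⟩ ⟨-, ht⟩
  exact (space_hasDerivAt hr ht θ).deriv

/-- Mixed partial derivatives commute. -/
lemma mixed_hasDerivAt {r : ℝ → ℝ → ℝ} {ω t : ℝ} {V : ℝ → ℝ}
    (hr : ContDiffOn ℝ (⊤ : ℕ∞) (fun p : ℝ × ℝ => r p.1 p.2) (strip ω))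
    (ht : t ∈ Set.Ioo 0 ω) (hV : ∀ u, HasDerivAt (fun τ => r u τ) (V u) t) (θ : ℝ) :
    HasDerivAt (fun τ => rdθ r θ τ) (deriv V θ) t ∧ HasDerivAt V (deriv V θ) θ := by
  set f : ℝ × ℝ → ℝ := fun p => r p.1 p.2 with hf
  have htI := Ioo_subset_Ico_self ht
  have hVe : V = fun u => fderivWithin ℝ f (strip ω) (u, t) (0, 1) := by
    funext u
    exact (hV u).unique (time_hasDerivAt hr ht u)
  have hV1 := space_hasDerivAt (dir_contDiffOn hr (0, 1)) htI θ
  have hV2 : HasDerivAt V (deriv V θ) θ := by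
    rw [hVe]; exact hV1.differentiableAt.hasDerivAt
  refine ⟨?_, hV2⟩
  have hP := time_hasDerivAt (rdθ_contDiffOn hr) ht θ
  have hP' := time_hasDerivAt (dir_contDiffOn hr (1, 0)) ht θ
  have heq : (fun τ => rdθ r θ τ) =ᶠ[nhds t]
      fun τ => fderivWithin ℝ f (strip ω) (θ, τ) (1, 0) := by
    filter_upwards [Ioo_mem_nhds ht.1 ht.2] with τ hτ
    exact (space_hasDerivAt hr (Ioo_subset_Ico_self hτ) θ).deriv
  have hP2 := hP'.congr_of_eventuallyEq heq
  refine hP2.congr_deriv ?_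
  rw [hVe, hV1.deriv]
  -- symmetric second derivative
  have hmem : ((θ, t) : ℝ × ℝ) ∈ strip ω := ⟨mem_univ _, htI⟩
  have hsym : IsSymmSndFDerivWithinAt ℝ f (strip ω) (θ, t) :=
    (hr (θ, t) hmem).isSymmSndFDerivWithinAt (by simpa using (WithTop.coe_le_coe.2 (le_top : (2 : ℕ∞) ≤ ⊤))) (strip_unique ω)
      (subset_closure (mem_interior_iff_mem_nhds.2 (strip_nhds ht θ))) hmem
  have hd : DifferentiableWithinAt ℝ (fderivWithin ℝ f (strip ω)) (strip ω) (θ, t) :=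
    (hr.fderivWithin (m := (⊤ : ℕ∞)) (strip_unique ω) (by simp)).differentiableOn (by simp) _ hmem
  have key : ∀ v w : ℝ × ℝ, fderivWithin ℝ (fun x => fderivWithin ℝ f (strip ω) x v) (strip ω)
      (θ, t) w = fderivWithin ℝ (fderivWithin ℝ f (strip ω)) (strip ω) (θ, t) w v := by
    intro v w
    rw [fderivWithin_clm_apply (strip_unique ω _ hmem) hd (by fun_prop)]
    simp
  rw [key, key]
  exact hsym _ _

/-- Differentiation under the integral sign. -/
lemma param_hasDerivAt {G : ℝ × ℝ → ℝ} {ω t : ℝ} (hG : ContDiffOn ℝ (⊤ : ℕ∞) G (strip ω))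
    (ht : t ∈ Set.Ioo 0 ω) (a b : ℝ) :
    Continuous (fun θ => deriv (fun τ => G (θ, τ)) t) ∧
    HasDerivAt (fun τ => ∫ θ in a..b, G (θ, τ)) (∫ θ in a..b, deriv (fun τ => G (θ, τ)) t) t := by
  obtain ⟨s, hs1, hs2⟩ := exists_between ht.1
  obtain ⟨T, hT1, hT2⟩ := exists_between ht.2
  set F' : ℝ → ℝ → ℝ := fun τ θ => fderivWithin ℝ G (strip ω) (θ, τ) (0, 1) with hF'
  have hcont : ContinuousOn (fun x => fderivWithin ℝ G (strip ω) x (0, 1)) (strip ω) :=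
    (dir_contDiffOn hG (0, 1)).continuousOn
  have hK : IsCompact (Set.uIcc a b ×ˢ Set.Icc s T) := isCompact_uIcc.prod isCompact_Icc
  have hKs : Set.uIcc a b ×ˢ Set.Icc s T ⊆ strip ω := by
    rintro ⟨x, y⟩ ⟨-, hy⟩
    exact ⟨mem_univ _, by exact hs1.le.trans hy.1, lt_of_le_of_lt hy.2 hT2⟩
  obtain ⟨C, hC⟩ := hK.exists_bound_of_continuousOn (hcont.mono hKs)
  have hsl : ∀ {H : ℝ × ℝ → ℝ}, ContinuousOn H (strip ω) → ∀ τ ∈ Set.Ioo 0 ω,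
      Continuous (fun θ => H (θ, τ)) := by
    intro H hH τ hτ
    exact hH.comp_continuous (by fun_prop) (fun θ => ⟨mem_univ _, Ioo_subset_Ico_self hτ⟩)
  have := intervalIntegral.hasDerivAt_integral_of_dominated_loc_of_deriv_le (μ := volume)
    (F := fun τ θ => G (θ, τ)) (F' := F') (x₀ := t) (a := a) (b := b) (s := Set.Ioo s T)
    (bound := fun _ => C) (Ioo_mem_nhds hs2 hT1)
    (by
      filter_upwards [Ioo_mem_nhds ht.1 ht.2] with τ hτ
      exact (hsl hG.continuousOn τ hτ).aestronglyMeasurable)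
    ((hsl hG.continuousOn t ht).intervalIntegrable _ _)
    ((hsl hcont t ht).aestronglyMeasurable)
    (by
      refine Eventually.of_forall fun θ hθ τ hτ => ?_
      exact hC (θ, τ) ⟨uIoc_subset_uIcc hθ, Ioo_subset_Icc_self hτ⟩)
    intervalIntegrable_const
    (by
      refine Eventually.of_forall fun θ hθ τ hτ => ?_
      exact time_hasDerivAt hG ⟨hs1.trans hτ.1, hτ.2.trans hT2⟩ θ)
  have hd : (fun θ => deriv (fun τ => G (θ, τ)) t) = F' t := by
    funext θ
    exact (time_hasDerivAt hG ht θ).deriv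
  rw [hd]
  exact ⟨hsl hcont t ht, this.2⟩

/-- Continuity of parametric integrals, up to the initial time. -/
lemma param_continuousOn {G : ℝ × ℝ → ℝ} {ω T : ℝ} (hG : ContinuousOn G (strip ω))
    (hT0 : 0 ≤ T) (hT : T < ω) (a b : ℝ) :
    ContinuousOn (fun τ => ∫ θ in a..b, G (θ, τ)) (Set.Icc 0 T) := by
  have h1 : Continuous (fun x : ℝ × ℝ => G (x.2, max 0 (min x.1 T))) := by
    refine hG.comp_continuous (by fun_prop) fun x => ⟨mem_univ _, ?_, ?_⟩
    · exact le_max_left _ _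
    · exact max_lt (hT0.trans_lt hT) ((min_le_right _ _).trans_lt hT)
  have h2 : Continuous (fun τ => ∫ θ in a..b, G (θ, max 0 (min τ T))) :=
    intervalIntegral.continuous_parametric_intervalIntegral_of_continuous'
      (f := fun τ θ => G (θ, max 0 (min τ T))) h1 a b
  refine h2.continuousOn.congr fun τ hτ => ?_
  simp [min_eq_left hτ.2, max_eq_right hτ.1]

lemma slice_contDiff {G : ℝ × ℝ → ℝ} {ω t : ℝ} (hG : ContDiffOn ℝ (⊤ : ℕ∞) G (strip ω))
    (ht : t ∈ Set.Ico 0 ω) : ContDiff ℝ (⊤ : ℕ∞) (fun u => G (u, t)) := by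
  rw [← contDiffOn_univ]
  exact hG.comp (t := strip ω) (s := Set.univ) (f := fun u : ℝ => (u, t)) (by fun_prop)
    (fun u _ => ⟨mem_univ _, ht⟩)

/-- A derivative at a one-sided (past) maximum is nonnegative. -/
lemma deriv_nonneg_of_past_max {φ : ℝ → ℝ} {D t : ℝ} (ht : 0 < t) (h : HasDerivAt φ D t)
    (hm : ∀ τ ∈ Set.Icc 0 t, φ τ ≤ φ t) : 0 ≤ D := by
  have h1 : HasDerivWithinAt φ D (Set.Iio t) t := h.hasDerivWithinAt
  rw [hasDerivWithinAt_iff_tendsto_slope' (by simp)] at h1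
  refine ge_of_tendsto h1 ?_
  filter_upwards [Ioo_mem_nhdsLT ht] with τ hτ
  rw [slope_def_field]
  exact div_nonneg_of_nonpos (by linarith [hm τ ⟨hτ.1.le, hτ.2.le⟩]) (by linarith [hτ.2])

/-- At a global maximum the first derivative vanishes and the second is nonpositive. -/
lemma max_second_deriv {φ φ' : ℝ → ℝ} {s x : ℝ} (h1 : ∀ u, HasDerivAt φ (φ' u) u)
    (h2 : HasDerivAt φ' s x) (hm : ∀ u, φ u ≤ φ x) : φ' x = 0 ∧ s ≤ 0 := by
  have hmax : IsLocalMax φ x := Eventually.of_forall hm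
  have h0 : φ' x = 0 := hmax.hasDerivAt_eq_zero (h1 x)
  refine ⟨h0, ?_⟩
  by_contra hs
  push Not at hs
  have hd : deriv φ = φ' := funext fun u => (h1 u).deriv
  have hmin : IsLocalMin φ x := by
    apply isLocalMin_of_deriv_deriv_pos
    · rw [hd, h2.deriv]; exact hs
    · rw [hd, h0]
    · exact (h1 x).continuousAt
  have hc : φ =ᶠ[nhds x] fun _ => φ x := by
    filter_upwards [hmin] with u hu
    exact le_antisymm (hm u) hu
  have hc2 : deriv φ =ᶠ[nhds x] fun _ => 0 := by
    have := hc.deriv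
    simpa using this
  have := hc2.deriv_eq
  rw [hd, h2.deriv] at this
  simp at this
  linarith

/-- The pointwise identity behind the monotonicity of the length. -/
lemma length_identity (r p q g a V W : ℝ) (hr : 0 < r) (hg : 0 < g) (hgg : g ^ 2 = r ^ 2 + p ^ 2)
    (hV : V = q / g ^ 2 - 2 / (r * g ^ 2) * p ^ 2 - r / g ^ 2 + a * g / r) :
    (-a + a ^ 2 * g + (a * ((1 / (1 + (p / r) ^ 2)) * ((q * r - p * p) / r ^ 2)) +
      ((q * V + p * W) * g - p * V * ((r * p + p * q) / g)) / g ^ 2)) - (r * V + p * W) / g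
      = g * ((r ^ 2 + 2 * p ^ 2 - r * q) / g ^ 3 - a) ^ 2 := by
  have hr' := hr.ne'
  have hg' := hg.ne'
  have e1 : (1 / (1 + (p / r) ^ 2)) * ((q * r - p * p) / r ^ 2) = (q * r - p ^ 2) / g ^ 2 := by
    have : 1 + (p / r) ^ 2 = g ^ 2 / r ^ 2 := by
      rw [hgg]; field_simp
    rw [this]; field_simp
  rw [e1]
  have e2 : ((q * V + p * W) * g - p * V * ((r * p + p * q) / g)) / g ^ 2
      = q * V / g + p * W / g - V * p ^ 2 * (r + q) / g ^ 3 := by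
    field_simp
  rw [e2]
  have hp : p ^ 2 = g ^ 2 - r ^ 2 := by linarith
  have e3 : (r * V + p * W) / g = r * V / g + p * W / g := by ring
  rw [e3, hV, hp]
  generalize p * W / g = Z
  field_simp
  ring

lemma reaction_neg (r P g a L : ℝ) (hr : 0 < r) (hL : 0 < L) (hrL : r ≤ L / 2)
    (hg : 0 < g) (hgg : g ^ 2 = r ^ 2 + P ^ 2) (ha : a = 2 * π / L) (hP : 3 * L / π < P) :
    2 * P ^ 4 + 5 * P ^ 2 * r ^ 2 + r ^ 4 - a * P ^ 2 * g ^ 3 < 0 := by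
  have hpi := Real.pi_pos
  have hP0 : 0 < P := lt_trans (by positivity) hP
  have h3 : 3 * L < P * π := (div_lt_iff₀ hpi).1 hP
  have haP : 6 ≤ a * P := by
    rw [ha, div_mul_eq_mul_div, le_div_iff₀ hL]; nlinarith
  have hgP : P ≤ g := by
    apply le_of_sq_le_sq _ hg.le
    nlinarith
  have hrP : r ≤ 2 / 3 * P := by
    nlinarith [Real.pi_le_four]
  have hr2 : r ^ 2 ≤ 4 / 9 * P ^ 2 := by nlinarith
  have hr4 : r ^ 4 ≤ 16 / 81 * P ^ 4 := by nlinarith [sq_nonneg r, sq_nonneg P]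
  have hg3 : P ^ 3 ≤ g ^ 3 := by gcongr
  have h4 : 6 * (P * P ^ 3) ≤ (a * P) * (P * g ^ 3) := by gcongr
  have hP4 : 0 < P ^ 4 := by positivity
  nlinarith [mul_le_mul_of_nonneg_left hr2 (sq_nonneg P)]

/-- Bundled hypotheses. -/
structure Sol (r : ℝ → ℝ → ℝ) (ω c : ℝ) : Prop where
  hc : 0 < c
  smooth : ContDiffOn ℝ (⊤ : ℕ∞) (fun p : ℝ × ℝ => r p.1 p.2) (strip ω)
  per : ∀ t ∈ Set.Ico (0:ℝ) ω, Function.Periodic (fun θ => r θ t) (2 * π)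
  gapf : RadialGAPF r (Set.Ico 0 ω)
  lower : ∀ θ : ℝ, ∀ t ∈ Set.Ico (0:ℝ) ω, c ≤ r θ t

namespace Sol

variable {r : ℝ → ℝ → ℝ} {ω c : ℝ}

lemma pos (h : Sol r ω c) {t : ℝ} (ht : t ∈ Set.Ico 0 ω) (θ : ℝ) : 0 < r θ t :=
  h.hc.trans_le (h.lower θ t ht)

lemma sum_pos (h : Sol r ω c) {t : ℝ} (ht : t ∈ Set.Ico 0 ω) (θ : ℝ) :
    0 < r θ t ^ 2 + rdθ r θ t ^ 2 := by
  have := h.pos ht θ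
  positivity

lemma met_pos (h : Sol r ω c) {t : ℝ} (ht : t ∈ Set.Ico 0 ω) (θ : ℝ) : 0 < rmet r θ t :=
  Real.sqrt_pos.2 (h.sum_pos ht θ)

lemma met_sq (h : Sol r ω c) {t : ℝ} (ht : t ∈ Set.Ico 0 ω) (θ : ℝ) :
    rmet r θ t ^ 2 = r θ t ^ 2 + rdθ r θ t ^ 2 :=
  Real.sq_sqrt (h.sum_pos ht θ).le

lemma smooth1 (h : Sol r ω c) :
    ContDiffOn ℝ (⊤ : ℕ∞) (fun p : ℝ × ℝ => rdθ r p.1 p.2) (strip ω) := rdθ_contDiffOn h.smooth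

lemma smooth2 (h : Sol r ω c) :
    ContDiffOn ℝ (⊤ : ℕ∞) (fun p : ℝ × ℝ => rdθθ r p.1 p.2) (strip ω) := rdθ_contDiffOn h.smooth1

lemma smooth_met (h : Sol r ω c) :
    ContDiffOn ℝ (⊤ : ℕ∞) (fun p : ℝ × ℝ => rmet r p.1 p.2) (strip ω) := by
  refine ContDiffOn.sqrt ((h.smooth.pow 2).add (h.smooth1.pow 2)) ?_
  rintro ⟨θ, t⟩ ⟨-, ht⟩
  exact (h.sum_pos ht θ).ne'

lemma hd0 (h : Sol r ω c) {t : ℝ} (ht : t ∈ Set.Ico 0 ω) (θ : ℝ) :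
    HasDerivAt (fun u => r u t) (rdθ r θ t) θ := rdθ_hasDerivAt h.smooth ht θ

lemma hd1 (h : Sol r ω c) {t : ℝ} (ht : t ∈ Set.Ico 0 ω) (θ : ℝ) :
    HasDerivAt (fun u => rdθ r u t) (rdθθ r θ t) θ := rdθ_hasDerivAt h.smooth1 ht θ

lemma hd2 (h : Sol r ω c) {t : ℝ} (ht : t ∈ Set.Ico 0 ω) (θ : ℝ) :
    HasDerivAt (fun u => rdθθ r u t) (rdθ (rdθθ r) θ t) θ := rdθ_hasDerivAt h.smooth2 ht θ

lemma hd_sqrt {α β : ℝ → ℝ} {α' β' x : ℝ} (ha : HasDerivAt α α' x) (hb : HasDerivAt β β' x)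
    (hp : 0 < α x ^ 2 + β x ^ 2) :
    HasDerivAt (fun u => Real.sqrt (α u ^ 2 + β u ^ 2))
      ((α x * α' + β x * β') / Real.sqrt (α x ^ 2 + β x ^ 2)) x := by
  have := ((ha.fun_pow 2).fun_add (hb.fun_pow 2)).sqrt hp.ne'
  convert this using 1
  have := Real.sqrt_pos.2 hp
  field_simp
  push_cast
  ring

lemma hd_met (h : Sol r ω c) {t : ℝ} (ht : t ∈ Set.Ico 0 ω) (θ : ℝ) :
    HasDerivAt (fun u => rmet r u t)
      ((r θ t * rdθ r θ t + rdθ r θ t * rdθθ r θ t) / rmet r θ t) θ :=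
  hd_sqrt (h.hd0 ht θ) (h.hd1 ht θ) (h.sum_pos ht θ)

lemma per_deriv {φ : ℝ → ℝ} {T : ℝ} (hφ : Function.Periodic φ T) :
    Function.Periodic (deriv φ) T := by
  intro x
  rw [← deriv_comp_add_const]
  congr 1
  exact funext hφ

lemma per1 (h : Sol r ω c) {t : ℝ} (ht : t ∈ Set.Ico 0 ω) :
    Function.Periodic (fun θ => rdθ r θ t) (2 * π) := per_deriv (h.per t ht)

lemma per2 (h : Sol r ω c) {t : ℝ} (ht : t ∈ Set.Ico 0 ω) :
    Function.Periodic (fun θ => rdθθ r θ t) (2 * π) := per_deriv (h.per1 ht)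

lemma per_met (h : Sol r ω c) {t : ℝ} (ht : t ∈ Set.Ico 0 ω) :
    Function.Periodic (fun θ => rmet r θ t) (2 * π) := by
  intro θ
  have h1 : r (θ + 2 * π) t = r θ t := h.per t ht θ
  have h2 : rdθ r (θ + 2 * π) t = rdθ r θ t := h.per1 ht θ
  simp only [rmet, h1, h2]

lemma met_cont (h : Sol r ω c) {t : ℝ} (ht : t ∈ Set.Ico 0 ω) :
    Continuous (fun θ => rmet r θ t) := (slice_contDiff h.smooth_met ht).continuous

lemma len_pos (h : Sol r ω c) {t : ℝ} (ht : t ∈ Set.Ico 0 ω) : 0 < rlen r t :=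
  intervalIntegral.intervalIntegral_pos_of_pos ((h.met_cont ht).intervalIntegrable _ _)
    (fun θ => h.met_pos ht θ) (by positivity)

/-- The radius is at most half of the length. -/
lemma half (h : Sol r ω c) {t : ℝ} (ht : t ∈ Set.Ico 0 ω) (θ : ℝ) : r θ t ≤ rlen r t / 2 := by
  set H : ℝ → ℝ := fun φ => r φ t * Real.cos (φ - θ) with hH
  have hdH : ∀ φ, HasDerivAt H
      (rdθ r φ t * Real.cos (φ - θ) + r φ t * (-Real.sin (φ - θ))) φ := by
    intro φ
    have h1 : HasDerivAt (fun φ : ℝ => Real.cos (φ - θ)) (-Real.sin (φ - θ)) φ := by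
      simpa using ((hasDerivAt_id φ).sub_const θ).cos
    exact (h.hd0 ht φ).mul h1
  have hc0 : Continuous (fun φ => r φ t) := (slice_contDiff h.smooth ht).continuous
  have hc1 : Continuous (fun φ => rdθ r φ t) := (slice_contDiff h.smooth1 ht).continuous
  have hcH : Continuous (fun φ => rdθ r φ t * Real.cos (φ - θ) +
      r φ t * (-Real.sin (φ - θ))) := by fun_prop
  have hab : ∀ φ, |rdθ r φ t * Real.cos (φ - θ) + r φ t * (-Real.sin (φ - θ))| ≤ rmet r φ t := by
    intro φ
    apply Real.abs_le_sqrt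
    nlinarith [sq_nonneg (rdθ r φ t * Real.sin (φ - θ) + r φ t * Real.cos (φ - θ)),
      Real.sin_sq_add_cos_sq (φ - θ)]
  have hint : ∀ x y, x ≤ y → |H y - H x| ≤ ∫ φ in x..y, rmet r φ t := by
    intro x y hxy
    rw [← intervalIntegral.integral_eq_sub_of_hasDerivAt (fun φ _ => hdH φ)
      (hcH.intervalIntegrable _ _)]
    refine (intervalIntegral.abs_integral_le_integral_abs hxy).trans ?_
    exact intervalIntegral.integral_mono_on hxy (hcH.abs.intervalIntegrable _ _)
      ((h.met_cont ht).intervalIntegrable _ _) (fun φ _ => hab φ)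
  have hpi := Real.pi_pos
  have i1 := hint θ (θ + π) (by linarith)
  have i2 := hint (θ + π) (θ + 2 * π) (by linarith)
  have hsum := intervalIntegral.integral_add_adjacent_intervals (μ := volume)
    ((h.met_cont ht).intervalIntegrable θ (θ + π))
    ((h.met_cont ht).intervalIntegrable (θ + π) (θ + 2 * π))
  have hL : ∫ φ in θ..(θ + 2 * π), rmet r φ t = rlen r t := by
    have := (h.per_met ht).intervalIntegral_add_eq θ 0
    simpa [rlen] using this
  have e0 : H θ = r θ t := by simp [hH]
  have e1 : H (θ + π) = - r (θ + π) t := by simp [hH]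
  have e2 : H (θ + 2 * π) = r θ t := by
    have h1 : r (θ + 2 * π) t = r θ t := h.per t ht θ
    simp [hH, h1]
  have := h.pos ht (θ + π)
  rw [e0, e1] at i1
  rw [e1, e2] at i2
  have := (abs_le.1 i1).1
  have := (abs_le.1 i2).2
  linarith

/-- The right-hand side of the radial equation. -/
def vel (r : ℝ → ℝ → ℝ) (θ t : ℝ) : ℝ :=
  rdθθ r θ t / rmet r θ t ^ 2 - 2 / (r θ t * rmet r θ t ^ 2) * rdθ r θ t ^ 2
    - r θ t / rmet r θ t ^ 2 + 2 * π * rmet r θ t / (r θ t * rlen r t)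

lemma hdt (h : Sol r ω c) {t : ℝ} (ht : t ∈ Set.Ioo 0 ω) (θ : ℝ) :
    HasDerivAt (fun τ => r θ τ) (vel r θ t) t :=
  (h.gapf t (Ioo_subset_Ico_self ht) θ).hasDerivAt (Ico_mem_nhds ht.1 ht.2)

lemma hdt1 (h : Sol r ω c) {t : ℝ} (ht : t ∈ Set.Ioo 0 ω) (θ : ℝ) :
    HasDerivAt (fun τ => rdθ r θ τ) (deriv (fun u => vel r u t) θ) t ∧
    HasDerivAt (fun u => vel r u t) (deriv (fun u => vel r u t) θ) θ :=
  mixed_hasDerivAt h.smooth ht (fun u => h.hdt ht u) θ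

lemma vel_contDiff (h : Sol r ω c) {t : ℝ} (ht : t ∈ Set.Ioo 0 ω) :
    ContDiff ℝ (⊤ : ℕ∞) (fun u => vel r u t) := by
  have hVe : (fun u => vel r u t) = fun u =>
      fderivWithin ℝ (fun p : ℝ × ℝ => r p.1 p.2) (strip ω) (u, t) (0, 1) := by
    funext u
    exact (h.hdt ht u).unique (time_hasDerivAt h.smooth ht u)
  rw [hVe]
  exact slice_contDiff (dir_contDiffOn h.smooth (0, 1)) (Ioo_subset_Ico_self ht)

lemma vel_per (h : Sol r ω c) {t : ℝ} (ht : t ∈ Set.Ico 0 ω) :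
    Function.Periodic (fun u => vel r u t) (2 * π) := by
  intro θ
  have h1 : r (θ + 2 * π) t = r θ t := h.per t ht θ
  have h2 : rdθ r (θ + 2 * π) t = rdθ r θ t := h.per1 ht θ
  have h3 : rdθθ r (θ + 2 * π) t = rdθθ r θ t := h.per2 ht θ
  have h4 : rmet r (θ + 2 * π) t = rmet r θ t := h.per_met ht θ
  simp only [vel, h1, h2, h3, h4]

/-- The length has a nonpositive time derivative. -/
lemma len_deriv (h : Sol r ω c) {t : ℝ} (ht : t ∈ Set.Ioo 0 ω) :
    ∃ D, HasDerivAt (fun τ => rlen r τ) D t ∧ D ≤ 0 := by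
  have htI := Ioo_subset_Ico_self ht
  obtain ⟨hcg, hder⟩ := param_hasDerivAt h.smooth_met ht 0 (2 * π)
  refine ⟨_, hder, ?_⟩
  have hLpos := h.len_pos htI
  set a : ℝ := 2 * π / rlen r t with ha
  set B : ℝ → ℝ := fun u => a * Real.arctan (rdθ r u t / r u t) +
    rdθ r u t * vel r u t / rmet r u t with hB
  have hBd : ∀ θ, HasDerivAt B
      (a * ((1 / (1 + (rdθ r θ t / r θ t) ^ 2)) *
        ((rdθθ r θ t * r θ t - rdθ r θ t * rdθ r θ t) / r θ t ^ 2)) +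
      ((rdθθ r θ t * vel r θ t + rdθ r θ t * deriv (fun u => vel r u t) θ) * rmet r θ t -
        rdθ r θ t * vel r θ t *
          ((r θ t * rdθ r θ t + rdθ r θ t * rdθθ r θ t) / rmet r θ t)) / rmet r θ t ^ 2) θ := by
    intro θ
    exact ((((h.hd1 htI θ).fun_div (h.hd0 htI θ) (h.pos htI θ).ne').arctan).const_mul a).fun_add
      (((h.hd1 htI θ).fun_mul (h.hdt1 ht θ).2).fun_div (h.hd_met htI θ) (h.met_pos htI θ).ne')
  have hBc : ContDiff ℝ (⊤ : ℕ∞) B := by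
    have c0 : ContDiff ℝ (⊤ : ℕ∞) (fun u => r u t) := slice_contDiff h.smooth htI
    have c1 : ContDiff ℝ (⊤ : ℕ∞) (fun u => rdθ r u t) := slice_contDiff h.smooth1 htI
    have cm : ContDiff ℝ (⊤ : ℕ∞) (fun u => rmet r u t) := slice_contDiff h.smooth_met htI
    exact (contDiff_const.mul ((c1.div c0 fun u => (h.pos htI u).ne').arctan)).add
      ((c1.mul (h.vel_contDiff ht)).div cm fun u => (h.met_pos htI u).ne')
  have hBc' : Continuous (deriv B) := hBc.continuous_deriv (by simp)
  have hBint : ∫ θ in (0:ℝ)..(2 * π), deriv B θ = 0 := by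
    rw [intervalIntegral.integral_eq_sub_of_hasDerivAt (f := B)
      (fun θ _ => (hBd θ).differentiableAt.hasDerivAt) (hBc'.intervalIntegrable _ _)]
    have h1 : r (2 * π) t = r 0 t := by simpa using h.per t htI 0
    have h2 : rdθ r (2 * π) t = rdθ r 0 t := by simpa using h.per1 htI 0
    have h4 : rmet r (2 * π) t = rmet r 0 t := by simpa using h.per_met htI 0
    have h5 : vel r (2 * π) t = vel r 0 t := by simpa using h.vel_per htI 0
    simp only [hB, h1, h2, h4, h5, sub_self]
  have hpt : ∀ θ, deriv (fun τ => rmet r θ τ) t ≤ (-a + a ^ 2 * rmet r θ t) + deriv B θ := by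
    intro θ
    have hgt : deriv (fun τ => rmet r θ τ) t =
        (r θ t * vel r θ t + rdθ r θ t * deriv (fun u => vel r u t) θ) / rmet r θ t :=
      (hd_sqrt (h.hdt ht θ) (h.hdt1 ht θ).1 (h.sum_pos htI θ)).deriv
    have hV : vel r θ t = rdθθ r θ t / rmet r θ t ^ 2
        - 2 / (r θ t * rmet r θ t ^ 2) * rdθ r θ t ^ 2
        - r θ t / rmet r θ t ^ 2 + a * rmet r θ t / r θ t := by
      rw [vel, ha]
      congr 1
      have := (h.pos htI θ).ne'
      field_simp
    have hid := length_identity (r θ t) (rdθ r θ t) (rdθθ r θ t) (rmet r θ t) a (vel r θ t)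
      (deriv (fun u => vel r u t) θ) (h.pos htI θ) (h.met_pos htI θ) (h.met_sq htI θ) hV
    rw [hgt, (hBd θ).deriv]
    have : 0 ≤ rmet r θ t * ((r θ t ^ 2 + 2 * rdθ r θ t ^ 2 - r θ t * rdθθ r θ t) /
        rmet r θ t ^ 3 - a) ^ 2 := mul_nonneg (h.met_pos htI θ).le (sq_nonneg _)
    rw [← hid] at this
    linarith
  have hmc := h.met_cont htI
  have hc1 : Continuous (fun θ => -a + a ^ 2 * rmet r θ t) := by fun_prop
  have hle : ∫ θ in (0:ℝ)..(2 * π), deriv (fun τ => rmet r θ τ) t ≤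
      ∫ θ in (0:ℝ)..(2 * π), ((-a + a ^ 2 * rmet r θ t) + deriv B θ) :=
    intervalIntegral.integral_mono_on (by positivity) (hcg.intervalIntegrable _ _)
      ((hc1.add hBc').intervalIntegrable _ _) (fun θ _ => hpt θ)
  refine hle.trans ?_
  rw [intervalIntegral.integral_add (hc1.intervalIntegrable _ _) (hBc'.intervalIntegrable _ _),
    hBint, intervalIntegral.integral_add (by simp)
      ((hmc.const_mul (a ^ 2)).intervalIntegrable _ _),
    intervalIntegral.integral_const_mul]
  change (∫ θ in (0:ℝ)..(2 * π), -a) + a ^ 2 * rlen r t + 0 ≤ 0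
  rw [intervalIntegral.integral_const, smul_eq_mul, ha]
  apply le_of_eq
  field_simp
  ring

lemma len_le (h : Sol r ω c) {t : ℝ} (ht : t ∈ Set.Ico 0 ω) : rlen r t ≤ rlen r 0 := by
  have hanti : AntitoneOn (fun τ => rlen r τ) (Set.Icc 0 t) := by
    apply antitoneOn_of_deriv_nonpos (convex_Icc 0 t)
    · exact param_continuousOn h.smooth_met.continuousOn ht.1 ht.2 0 (2 * π)
    · intro τ hτ
      rw [interior_Icc] at hτ
      obtain ⟨D, hD, -⟩ := h.len_deriv (t := τ) ⟨hτ.1, hτ.2.trans ht.2⟩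
      exact hD.differentiableAt.differentiableWithinAt
    · intro τ hτ
      rw [interior_Icc] at hτ
      obtain ⟨D, hD, hD0⟩ := h.len_deriv (t := τ) ⟨hτ.1, hτ.2.trans ht.2⟩
      rw [hD.deriv]
      exact hD0
  exact hanti ⟨le_rfl, ht.1⟩ ⟨ht.1, le_rfl⟩ ht.1

/-- Spatial derivative of the velocity at a critical point of `∂r/∂θ`. -/
lemma vel_deriv (h : Sol r ω c) {t : ℝ} (ht : t ∈ Set.Ico 0 ω) (θ : ℝ) (hq : rdθθ r θ t = 0) :
    HasDerivAt (fun u => vel r u t)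
      (rdθ (rdθθ r) θ t / rmet r θ t ^ 2 + rdθ r θ t *
        ((2 * rdθ r θ t ^ 4 + 5 * rdθ r θ t ^ 2 * r θ t ^ 2 + r θ t ^ 4
          - 2 * π / rlen r t * rdθ r θ t ^ 2 * rmet r θ t ^ 3) /
          (r θ t ^ 2 * rmet r θ t ^ 4))) θ := by
  have hr := (h.pos ht θ).ne'
  have hg := (h.met_pos ht θ).ne'
  have hL := (h.len_pos ht).ne'
  have d0 := h.hd0 ht θ
  have d1 := h.hd1 ht θ
  have d2 := h.hd2 ht θ
  have dg := h.hd_met ht θ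
  have hsq := h.met_sq ht θ
  have dg2 := dg.fun_pow 2
  have A1 := d2.fun_div dg2 (pow_ne_zero 2 hg)
  have A2 := ((hasDerivAt_const θ (2:ℝ)).fun_div (d0.fun_mul dg2)
    (mul_ne_zero hr (pow_ne_zero 2 hg))).fun_mul (d1.fun_pow 2)
  have A3 := d0.fun_div dg2 (pow_ne_zero 2 hg)
  have A4 := (dg.const_mul (2 * π)).fun_div (d0.mul_const (rlen r t)) (mul_ne_zero hr hL)
  refine (((A1.fun_sub A2).fun_sub A3).fun_add A4).congr_deriv ?_
  rw [hq]
  generalize rdθ (rdθθ r) θ t = s at *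
  generalize rmet r θ t = g at *
  generalize r θ t = x at *
  generalize rdθ r θ t = p at *
  generalize rlen r t = L at *
  clear A1 A2 A3 A4 dg2 dg d0 d1 d2
  have hx2 : x ^ 2 = g ^ 2 - p ^ 2 := by linarith
  field_simp
  push_cast
  grind

/-- The maximum principle at a space-time maximum. -/
lemma no_max (h : Sol r ω c) {t θ σ : ℝ} (ht : t ∈ Set.Ioo 0 ω) (hσ : σ = 1 ∨ σ = -1)
    (hbig : 3 * rlen r 0 / π < σ * rdθ r θ t)
    (hspace : ∀ u, σ * rdθ r u t ≤ σ * rdθ r θ t)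
    (htime : ∀ τ ∈ Set.Icc 0 t, σ * rdθ r θ τ ≤ σ * rdθ r θ t) : False := by
  have htI := Ioo_subset_Ico_self ht
  have hσ0 : σ ≠ 0 := by rcases hσ with rfl | rfl <;> norm_num
  have hσ2 : σ ^ 2 = 1 := by rcases hσ with rfl | rfl <;> norm_num
  have hσ4 : σ ^ 4 = 1 := by rcases hσ with rfl | rfl <;> norm_num
  obtain ⟨hq, hs⟩ := max_second_deriv (fun u => (h.hd1 htI u).const_mul σ)
    ((h.hd2 htI θ).const_mul σ) hspace
  have hq0 : rdθθ r θ t = 0 := by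
    rcases mul_eq_zero.1 hq with h1 | h1
    · exact absurd h1 hσ0
    · exact h1
  have hD := deriv_nonneg_of_past_max ht.1 (((h.hdt1 ht θ).1).const_mul σ) htime
  rw [(h.vel_deriv htI θ hq0).deriv] at hD
  have hr := h.pos htI θ
  have hg := h.met_pos htI θ
  have hL := h.len_pos htI
  have hP : 3 * rlen r t / π < σ * rdθ r θ t := by
    refine lt_of_le_of_lt ?_ hbig
    have := h.len_le htI
    have := Real.pi_pos
    gcongr
  have hneg := reaction_neg (r θ t) (σ * rdθ r θ t) (rmet r θ t) (2 * π / rlen r t) (rlen r t)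
    hr hL (h.half htI θ) hg (by rw [mul_pow, hσ2, one_mul]; exact h.met_sq htI θ) rfl hP
  rw [mul_pow, mul_pow, hσ2, hσ4, one_mul, one_mul] at hneg
  have hP0 : 0 < σ * rdθ r θ t := lt_trans (by have := Real.pi_pos; positivity) hP
  have h1 : σ * rdθ (rdθθ r) θ t / rmet r θ t ^ 2 ≤ 0 :=
    div_nonpos_of_nonpos_of_nonneg hs (by positivity)
  have h2 := mul_neg_of_pos_of_neg hP0
    (div_neg_of_neg_of_pos hneg (show 0 < r θ t ^ 2 * rmet r θ t ^ 4 by positivity))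
  rw [mul_add, ← mul_assoc, ← mul_div_assoc] at hD
  linarith

end Sol

/-- A priori bounds for the radial equation of Gage's area-preserving flow: if
`r ≥ c > 0` on `[0,2π] × [0,ω)`, then `r ≤ L₀/2` and
`|∂r/∂θ| ≤ C₁ = max{max_θ |∂r/∂θ(θ,0)|, 3L₀/π}`, where `L₀ = L(0)`. -/
theorem radial_gapf_gradient_bound
    (r : ℝ → ℝ → ℝ) (ω c : ℝ) (hω : 0 < ω) (hc : 0 < c)
    (hsmooth : ContDiffOn ℝ (⊤ : ℕ∞) (fun p : ℝ × ℝ => r p.1 p.2)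
      (Set.univ ×ˢ Set.Ico 0 ω))
    (hper : ∀ t ∈ Set.Ico (0:ℝ) ω, Function.Periodic (fun θ => r θ t) (2 * π))
    (hgapf : RadialGAPF r (Set.Ico 0 ω))
    (hlower : ∀ θ : ℝ, ∀ t ∈ Set.Ico (0:ℝ) ω, c ≤ r θ t) :
    ∀ θ : ℝ, ∀ t ∈ Set.Ico (0:ℝ) ω,
      r θ t ≤ rlen r 0 / 2 ∧
      |rdθ r θ t| ≤
        max (sSup ((fun ψ => |rdθ r ψ 0|) '' Set.Icc (0:ℝ) (2 * π)))
          (3 * rlen r 0 / π) := by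
  have h : Sol r ω c := ⟨hc, hsmooth, hper, hgapf, hlower⟩
  intro θ t ht
  refine ⟨(h.half ht θ).trans (by linarith [h.len_le ht]), ?_⟩
  by_contra hcon
  push Not at hcon
  have hpi := Real.pi_pos
  have h2pi : 0 < 2 * π := by positivity
  have hKs : Set.Icc 0 (2 * π) ×ˢ Set.Icc 0 t ⊆ strip ω := by
    rintro ⟨x, y⟩ ⟨-, hy⟩
    exact ⟨mem_univ _, hy.1, lt_of_le_of_lt hy.2 ht.2⟩
  have hcont : ContinuousOn (fun x : ℝ × ℝ => |rdθ r x.1 x.2|)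
      (Set.Icc 0 (2 * π) ×ˢ Set.Icc 0 t) := (h.smooth1.continuousOn.mono hKs).abs
  obtain ⟨⟨θs, ts⟩, ⟨hθs, hts⟩, hmax⟩ := (isCompact_Icc.prod isCompact_Icc).exists_isMaxOn
    ⟨((0 : ℝ), (0 : ℝ)), ⟨le_rfl, h2pi.le⟩, ⟨le_rfl, ht.1⟩⟩ hcont
  have hmax' : ∀ u, ∀ τ ∈ Set.Icc 0 t, |rdθ r u τ| ≤ |rdθ r θs ts| := by
    intro u τ hτ
    obtain ⟨y, hy, hyu⟩ := (h.per1 (t := τ) ⟨hτ.1, hτ.2.trans_lt ht.2⟩).exists_mem_Ico₀ h2pi u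
    have hyu' : rdθ r u τ = rdθ r y τ := hyu
    rw [hyu']
    exact hmax (show ((y, τ) : ℝ × ℝ) ∈ _ from ⟨Ico_subset_Icc_self hy, hτ⟩)
  have hbig := hcon.trans_le (hmax' θ t ⟨ht.1, le_rfl⟩)
  simp only at hts hθs
  have hts0 : 0 < ts := by
    rcases hts.1.lt_or_eq with h1 | h1
    · exact h1
    · exfalso
      rw [← h1] at hbig
      have hb : BddAbove ((fun ψ => |rdθ r ψ 0|) '' Set.Icc (0:ℝ) (2 * π)) := by
        have hc0 : Continuous (fun ψ => rdθ r ψ 0) :=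
          (slice_contDiff h.smooth1 (t := 0) ⟨le_rfl, hω⟩).continuous
        exact (isCompact_Icc.image hc0.abs).bddAbove
      have := le_csSup hb ⟨θs, hθs, rfl⟩
      exact absurd (this.trans (le_max_left _ _)) (not_le.2 hbig)
  have htsI : ts ∈ Set.Ioo 0 ω := ⟨hts0, hts.2.trans_lt ht.2⟩
  have hbig2 := (le_max_right _ _).trans_lt hbig
  have hts' : ∀ τ ∈ Set.Icc 0 ts, τ ∈ Set.Icc 0 t := fun τ hτ => ⟨hτ.1, hτ.2.trans hts.2⟩
  rcases abs_cases (rdθ r θs ts) with ⟨h1, -⟩ | ⟨h1, -⟩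
  · refine h.no_max htsI (Or.inl rfl) (θ := θs) (by rw [one_mul, ← h1]; exact hbig2) ?_ ?_
    · intro u
      rw [one_mul, one_mul, ← h1]
      exact (le_abs_self _).trans (hmax' u ts hts)
    · intro τ hτ
      rw [one_mul, one_mul, ← h1]
      exact (le_abs_self _).trans (hmax' θs τ (hts' τ hτ))
  · refine h.no_max htsI (Or.inr rfl) (θ := θs) (by rw [neg_one_mul, ← h1]; exact hbig2) ?_ ?_
    · intro u
      rw [neg_one_mul, neg_one_mul, ← h1]
      exact (neg_le_abs _).trans (hmax' u ts hts)
    · intro τ hτ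
      rw [neg_one_mul, neg_one_mul, ← h1]
      exact (neg_le_abs _).trans (hmax' θs τ (hts' τ hτ))
end
end

section
/- Let X₀ be a smooth, embedded, closed plane curve with enclosed area A₀, star-shaped and centrosymmetric with respect to the origin O. Let Y(·,t), t ∈ [0, A₀/(2π)), be the smooth embedded solution of the curve shortening flow ∂Y/∂t = κ̃ Ñ with Y(·,0) = X₀ (which, by Grayson's theorem, exists, stays embedded, and shrinks to a point as t → A₀/(2π)). Then Y(·,t) is star-shaped with respect to O for every t ∈ [0, A₀/(2π)). -/
open Real Set MeasureTheory Filter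

noncomputable section

/-- Euclidean norm of a plane vector. -/
def vnorm (v : ℝ × ℝ) : ℝ := Real.sqrt (v.1 ^ 2 + v.2 ^ 2)

/-- Determinant of the 2×2 matrix whose rows are the plane vectors `a`, `b`. -/
def vdet (a b : ℝ × ℝ) : ℝ := a.1 * b.2 - a.2 * b.1

/-- Unit tangent vector of a plane curve. -/
def unitTangent (X : ℝ → ℝ × ℝ) (φ : ℝ) : ℝ × ℝ :=
  (vnorm (deriv X φ))⁻¹ • deriv X φ

/-- Inward unit normal: the rotation of the unit tangent by +π/2. -/
def innerNormal (X : ℝ → ℝ × ℝ) (φ : ℝ) : ℝ × ℝ :=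
  (-(unitTangent X φ).2, (unitTangent X φ).1)

/-- Curvature of a plane curve. -/
def curv (X : ℝ → ℝ × ℝ) (φ : ℝ) : ℝ :=
  vdet (deriv X φ) (deriv (deriv X) φ) / vnorm (deriv X φ) ^ 3

/-- Length of a closed plane curve parametrized on `[0, 2π]`. -/
def clen (X : ℝ → ℝ × ℝ) : ℝ := ∫ φ in (0:ℝ)..(2 * π), vnorm (deriv X φ)

/-- Enclosed area of a closed plane curve. -/
def carea (X : ℝ → ℝ × ℝ) : ℝ :=
  (1 / 2) * ∫ φ in (0:ℝ)..(2 * π), vdet (X φ) (deriv X φ)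

/-- A smooth closed plane curve: a smooth `2π`-periodic map `ℝ → ℝ²` with
nonvanishing derivative. -/
structure IsSmoothClosedCurve (X : ℝ → ℝ × ℝ) : Prop where
  smooth : ContDiff ℝ (⊤ : ℕ∞) X
  periodic : Function.Periodic X (2 * π)
  regular : ∀ φ, deriv X φ ≠ 0

/-- An embedded closed curve: injective over one period. -/
def IsEmbeddedCurve (X : ℝ → ℝ × ℝ) : Prop := Set.InjOn X (Set.Ico 0 (2 * π))

/-- Star-shapedness with respect to a point `O`: `det(X − O, T) > 0` everywhere. -/
def StarShapedWrt (X : ℝ → ℝ × ℝ) (O : ℝ × ℝ) : Prop :=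
  ∀ φ, 0 < vdet (X φ - O) (unitTangent X φ)

/-- Centrosymmetry with respect to a point `O`: the image of the curve is invariant
under the point reflection `Z ↦ 2O − Z`. -/
def CentroSymmetricWrt (X : ℝ → ℝ × ℝ) (O : ℝ × ℝ) : Prop :=
  (fun Z => (2 : ℝ) • O - Z) '' Set.range X = Set.range X

/-- `X` is a smooth solution of Gage's area-preserving flow on the time set `I`
with initial curve `X₀`: `∂X/∂t = α T + (κ − 2π/L) N`. -/
structure IsGAPFSolutionOn (X : ℝ → ℝ → ℝ × ℝ) (X₀ : ℝ → ℝ × ℝ) (I : Set ℝ) : Prop where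
  init : ∀ φ, X 0 φ = X₀ φ
  curve : ∀ t ∈ I, IsSmoothClosedCurve (X t)
  smooth : ContDiffOn ℝ (⊤ : ℕ∞) (fun p : ℝ × ℝ => X p.1 p.2) (I ×ˢ Set.univ)
  flow : ∃ α : ℝ → ℝ → ℝ,
    ∀ t ∈ I, ∀ φ,
      HasDerivWithinAt (fun τ => X τ φ)
        (α t φ • unitTangent (X t) φ +
          (curv (X t) φ - 2 * π / clen (X t)) • innerNormal (X t) φ) I t
/-- `Y` is a smooth solution of the curve shortening flow (up to a tangential term)
on the time set `I` with initial curve `X₀`: `∂Y/∂t = α T + κ N`. -/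
structure IsCSFSolutionOn (Y : ℝ → ℝ → ℝ × ℝ) (X₀ : ℝ → ℝ × ℝ) (I : Set ℝ) : Prop where
  init : ∀ φ, Y 0 φ = X₀ φ
  curve : ∀ t ∈ I, IsSmoothClosedCurve (Y t)
  smooth : ContDiffOn ℝ (⊤ : ℕ∞) (fun p : ℝ × ℝ => Y p.1 p.2) (I ×ˢ Set.univ)
  flow : ∃ α : ℝ → ℝ → ℝ,
    ∀ t ∈ I, ∀ φ,
      HasDerivWithinAt (fun τ => Y τ φ)
        (α t φ • unitTangent (Y t) φ + curv (Y t) φ • innerNormal (Y t) φ) I t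



def vdot (a b : ℝ × ℝ) : ℝ := a.1 * b.1 + a.2 * b.2

lemma csf_max_principle {E : Type*} [TopologicalSpace E] (K : Set E) (hK : IsCompact K)
    (f : ℝ → E → ℝ) (t₁ δ : ℝ)
    (hc : ContinuousOn (fun p : ℝ × E => f p.1 p.2) (Icc 0 t₁ ×ˢ K))
    (h0 : ∀ x ∈ K, δ ≤ f 0 x)
    (hd : ∀ t ∈ Ioc 0 t₁, ∀ x ∈ K, (∀ y ∈ K, f t x ≤ f t y) → f t x < δ →
      ∃ d, 0 ≤ d ∧ HasDerivAt (fun τ => f τ x) d t) :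
    ∀ t ∈ Icc 0 t₁, ∀ x ∈ K, δ ≤ f t x := by
  intro t ht x hx
  by_contra! hlt
  have htpos : 0 < t := by
    rcases ht.1.lt_or_eq with h | h
    · exact h
    · subst h; exact absurd (h0 x hx) (not_le.2 hlt)
  obtain ⟨ε, hε, hε2⟩ : ∃ ε > 0, f t x + ε * t < δ := by
    refine ⟨(δ - f t x) / (2 * t), by have := sub_pos.2 hlt; positivity, ?_⟩
    have : (δ - f t x) / (2 * t) * t = (δ - f t x) / 2 := by field_simp
    rw [this]; linarith
  have hsub : Icc 0 t ×ˢ K ⊆ Icc 0 t₁ ×ˢ K := by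
    apply Set.prod_mono _ le_rfl
    exact Icc_subset_Icc le_rfl ht.2
  obtain ⟨⟨s, y⟩, hsy, hmin⟩ := (isCompact_Icc.prod hK).exists_isMinOn
    (s := Icc 0 t ×ˢ K) ⟨(t, x), ⟨⟨htpos.le, le_rfl⟩, hx⟩⟩
    (f := fun p : ℝ × E => f p.1 p.2 + ε * p.1)
    ((hc.mono hsub).add (by fun_prop))
  have hval : f s y + ε * s < δ := by
    have := hmin (show (t, x) ∈ Icc 0 t ×ˢ K from ⟨⟨htpos.le, le_rfl⟩, hx⟩)
    simp only [mem_ofPred_eq] at this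
    linarith
  obtain ⟨hs, hy⟩ := hsy
  simp only at hs hy
  have hspos : 0 < s := by
    rcases hs.1.lt_or_eq with h | h
    · exact h
    · subst h; have := h0 y hy; simp at hval; linarith
  obtain ⟨d, hd0, hder⟩ := hd s ⟨hspos, hs.2.trans ht.2⟩ y hy (by
    intro z hz
    have := hmin (show (s, z) ∈ Icc 0 t ×ˢ K from ⟨hs, hz⟩)
    simp only [mem_ofPred_eq] at this
    linarith) (by have : 0 < ε * s := by positivity
                  linarith)
  have hder2 : HasDerivAt (fun τ => f τ y + ε * τ) (d + ε) s := by
    exact (hder.add ((hasDerivAt_id s).const_mul ε)).congr_deriv (by simp)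
  have hpos : 0 < d + ε := by linarith
  have hev : ∀ᶠ τ in nhdsWithin s (Iio s), 0 < slope (fun τ => f τ y + ε * τ) s τ := by
    have h1 := (hasDerivAt_iff_tendsto_slope.1 hder2).mono_left
      (nhdsWithin_mono s (fun z (hz : z < s) => (ne_of_lt hz : z ≠ s)))
    exact h1.eventually (lt_mem_nhds hpos)
  have hev2 : ∀ᶠ τ in nhdsWithin s (Iio s), τ ∈ Ioo 0 s := Ioo_mem_nhdsLT hspos
  obtain ⟨τ, h1, h2⟩ := (hev.and hev2).exists
  have h3 := hmin (show (τ, y) ∈ Icc 0 t ×ˢ K from ⟨⟨h2.1.le, h2.2.le.trans hs.2⟩, hy⟩)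
  simp only [mem_ofPred_eq] at h3
  rw [slope_def_field] at h1
  have h4 : τ - s < 0 := by linarith [h2.2]
  have := div_nonpos_of_nonneg_of_nonpos (sub_nonneg.2 h3) h4.le
  linarith

lemma csf_second_deriv (f f' : ℝ → ℝ) (x c : ℝ) (h1 : ∀ y, HasDerivAt f (f' y) y)
    (h2 : HasDerivAt f' c x) (hmin : ∀ y, f x ≤ f y) : f' x = 0 ∧ 0 ≤ c := by
  have hl : IsLocalMin f x := Eventually.of_forall hmin
  have h0 : f' x = 0 := hl.hasDerivAt_eq_zero (h1 x)
  refine ⟨h0, ?_⟩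
  by_contra! hc
  have hdf : deriv f = f' := funext fun y => (h1 y).deriv
  have hmax : IsLocalMax f x := by
    apply isLocalMax_of_deriv_deriv_neg
    · rw [hdf, h2.deriv]; exact hc
    · rw [hdf]; exact h0
    · exact (h1 x).continuousAt
  have heq : f =ᶠ[nhds x] fun _ => f x := by
    filter_upwards [hmax] with y hy
    exact le_antisymm hy (hmin y)
  have h3 : f' =ᶠ[nhds x] fun _ => (0:ℝ) := by
    have := heq.deriv
    rw [hdf] at this
    simpa using this
  have h4 := h3.deriv_eq
  rw [h2.deriv] at h4
  simp at h4
  linarith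

lemma csf_fst {X : ℝ → ℝ × ℝ} {v : ℝ × ℝ} {φ : ℝ} (h : HasDerivAt X v φ) :
    HasDerivAt (fun s => (X s).1) v.1 φ :=
  (hasFDerivAt_fst (𝕜 := ℝ) (p := X φ)).comp_hasDerivAt φ h

lemma csf_snd {X : ℝ → ℝ × ℝ} {v : ℝ × ℝ} {φ : ℝ} (h : HasDerivAt X v φ) :
    HasDerivAt (fun s => (X s).2) v.2 φ :=
  (hasFDerivAt_snd (𝕜 := ℝ) (p := X φ)).comp_hasDerivAt φ h

lemma csf_d1 {X : ℝ → ℝ × ℝ} (h : ContDiff ℝ (⊤ : ℕ∞) X) (φ : ℝ) :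
    HasDerivAt X (deriv X φ) φ :=
  ((h.differentiable (by simp)) φ).hasDerivAt

lemma csf_deriv_smooth {X : ℝ → ℝ × ℝ} (h : ContDiff ℝ (⊤ : ℕ∞) X) :
    ContDiff ℝ (⊤ : ℕ∞) (deriv X) :=
  ContDiff.iterate_deriv 1 h

lemma vnorm_sq (v : ℝ × ℝ) : vnorm v ^ 2 = v.1 ^ 2 + v.2 ^ 2 := by
  unfold vnorm; exact Real.sq_sqrt (by positivity)

lemma vnorm_nonneg (v : ℝ × ℝ) : 0 ≤ vnorm v := Real.sqrt_nonneg _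

lemma vnorm_pos {v : ℝ × ℝ} (h : v ≠ 0) : 0 < vnorm v := by
  unfold vnorm
  apply Real.sqrt_pos.2
  by_contra! hh
  apply h
  have h1 : v.1 = 0 := by nlinarith [sq_nonneg v.1, sq_nonneg v.2]
  have h2 : v.2 = 0 := by nlinarith [sq_nonneg v.1, sq_nonneg v.2]
  exact Prod.ext h1 h2

lemma vnorm_cont : Continuous vnorm := by
  unfold vnorm; fun_prop

lemma csf_normal_part (X : ℝ → ℝ × ℝ) (φ α : ℝ) (w : ℝ × ℝ) (hr : deriv X φ ≠ 0)
    (hw : vdot w (deriv X φ) = 0) :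
    vdot w (α • unitTangent X φ + curv X φ • innerNormal X φ) * vnorm (deriv X φ) ^ 2
      = vdot w (deriv (deriv X) φ) := by
  have hl := vnorm_pos hr
  have hsq := vnorm_sq (deriv X φ)
  simp only [vdot, curv, innerNormal, unitTangent, vdet, Prod.fst_add, Prod.snd_add, Prod.smul_fst,
    Prod.smul_snd, smul_eq_mul] at *
  generalize vnorm (deriv X φ) = l at *
  generalize (deriv (deriv X) φ) = c at *
  generalize (deriv X φ) = e at *
  obtain ⟨a, b⟩ := e
  obtain ⟨c, d⟩ := c
  obtain ⟨u, v⟩ := w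
  simp only at *
  have key : (u * (-b) + v * a) * (a * d - b * c) = (u * c + v * d) * l ^ 2 := by
    rw [hsq]
    linear_combination (-(a * c + b * d)) * hw
  field_simp
  linear_combination (l^3 * α) * hw + key

lemma csf_avoid_pointwise (Y Z : ℝ → ℝ × ℝ) (hY : ContDiff ℝ (⊤ : ℕ∞) Y)
    (hZ : ContDiff ℝ (⊤ : ℕ∞) Z) (a b α β : ℝ) (hYr : deriv Y a ≠ 0) (hZr : deriv Z b ≠ 0)
    (hmin : ∀ φ ψ, vdot (Y a - Z b) (Y a - Z b) ≤ vdot (Y φ - Z ψ) (Y φ - Z ψ)) :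
    0 ≤ vdot (Y a - Z b) ((α • unitTangent Y a + curv Y a • innerNormal Y a) -
      (β • unitTangent Z b + curv Z b • innerNormal Z b)) := by
  have line : ∀ p q : ℝ,
      vdot (Y a - Z b) (p • deriv Y a - q • deriv Z b) = 0 ∧
      0 ≤ vdot (p • deriv Y a - q • deriv Z b) (p • deriv Y a - q • deriv Z b) +
        vdot (Y a - Z b) (p ^ 2 • deriv (deriv Y) a - q ^ 2 • deriv (deriv Z) b) := by
    intro p q
    have hl1 : ∀ s, HasDerivAt (fun s : ℝ => a + p * s) p s := fun s => by
      simpa using ((hasDerivAt_id s).const_mul p).const_add a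
    have hl2 : ∀ s, HasDerivAt (fun s : ℝ => b + q * s) q s := fun s => by
      simpa using ((hasDerivAt_id s).const_mul q).const_add b
    have hw : ∀ s, HasDerivAt (fun s => Y (a + p * s) - Z (b + q * s))
        (p • deriv Y (a + p * s) - q • deriv Z (b + q * s)) s := fun s =>
      ((csf_d1 hY _).scomp s (hl1 s)).sub ((csf_d1 hZ _).scomp s (hl2 s))
    have hw' : ∀ s, HasDerivAt (fun s => p • deriv Y (a + p * s) - q • deriv Z (b + q * s))
        (p • p • deriv (deriv Y) (a + p * s) - q • q • deriv (deriv Z) (b + q * s)) s := fun s =>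
      (((csf_d1 (csf_deriv_smooth hY) _).scomp s (hl1 s)).const_smul p).sub
        (((csf_d1 (csf_deriv_smooth hZ) _).scomp s (hl2 s)).const_smul q)
    have := csf_second_deriv
      (fun s => vdot (Y (a + p * s) - Z (b + q * s)) (Y (a + p * s) - Z (b + q * s)))
      (fun s => 2 * vdot (Y (a + p * s) - Z (b + q * s))
        (p • deriv Y (a + p * s) - q • deriv Z (b + q * s))) 0
      (2 * (vdot (p • deriv Y a - q • deriv Z b) (p • deriv Y a - q • deriv Z b) +
        vdot (Y a - Z b) (p ^ 2 • deriv (deriv Y) a - q ^ 2 • deriv (deriv Z) b)))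
      (fun s => by
        have h1 := csf_fst (hw s)
        have h2 := csf_snd (hw s)
        refine ((h1.mul h1).add (h2.mul h2)).congr_deriv ?_
        simp only [vdot]; ring)
      (by
        have h1 := csf_fst (hw 0)
        have h2 := csf_snd (hw 0)
        have h3 := csf_fst (hw' 0)
        have h4 := csf_snd (hw' 0)
        refine (((h1.mul h3).add (h2.mul h4)).const_mul 2).congr_deriv ?_
        simp [vdot]; ring)
      (fun s => by simpa using hmin _ _)
    simp only [mul_zero, add_zero] at this
    constructor
    · linarith [this.1]
    · linarith [this.2]
  have hw1 : vdot (Y a - Z b) (deriv Y a) = 0 := by simpa using (line 1 0).1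
  have hw2 : vdot (Y a - Z b) (deriv Z b) = 0 := by
    have := (line 0 1).1
    simp [vdot] at this ⊢
    linarith
  by_cases hw0 : Y a - Z b = 0
  · rw [hw0]; simp [vdot]
  have n1 := csf_normal_part Y a α _ hYr hw1
  have n2 := csf_normal_part Z b β _ hZr hw2
  have l1 := vnorm_pos hYr
  have l2 := vnorm_pos hZr
  have hk : ∃ k : ℝ, deriv Z b = k • deriv Y a := by
    have hs := vnorm_sq (deriv Y a)
    have hs2 := vnorm_sq (Y a - Z b)
    have l3 := vnorm_pos hw0
    refine ⟨vdot (deriv Z b) (deriv Y a) / vnorm (deriv Y a) ^ 2, ?_⟩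
    have hdet : vdet (deriv Y a) (deriv Z b) = 0 := by
      have : vdet (deriv Y a) (deriv Z b) * vnorm (Y a - Z b) ^ 2 = 0 := by
        rw [hs2]
        simp only [vdot, vdet] at *
        generalize (Y a - Z b) = w at *
        linear_combination (w.1 * (deriv Z b).2 - w.2 * (deriv Z b).1) * hw1 + (w.2 * (deriv Y a).1 - w.1 * (deriv Y a).2) * hw2
      rcases mul_eq_zero.1 this with h | h
      · exact h
      · exact absurd h (by positivity)
    simp only [vdot, vdet] at *
    ext
    · simp only [Prod.smul_fst, smul_eq_mul]
      field_simp
      rw [hs]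
      linear_combination (-(deriv Y a).2) * hdet
    · simp only [Prod.smul_snd, smul_eq_mul]
      field_simp
      rw [hs]
      linear_combination ((deriv Y a).1) * hdet
  obtain ⟨k, hk⟩ := hk
  have hk0 : k ≠ 0 := by
    rintro rfl
    simp at hk; exact hZr hk
  have hl : vnorm (deriv Z b) ^ 2 = k ^ 2 * vnorm (deriv Y a) ^ 2 := by
    rw [vnorm_sq, vnorm_sq, hk]; simp; ring
  have hsec := (line k 1).2
  rw [hk] at hsec
  have hsec2 : 0 ≤ k ^ 2 * vdot (Y a - Z b) (deriv (deriv Y) a) -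
      vdot (Y a - Z b) (deriv (deriv Z) b) := by
    simp [vdot] at hsec ⊢
    linarith
  rw [← n1, ← n2, hl] at hsec2
  generalize (α • unitTangent Y a + curv Y a • innerNormal Y a) = V1 at *
  generalize (β • unitTangent Z b + curv Z b • innerNormal Z b) = V2 at *
  have h5 : 0 ≤ (k ^ 2 * vnorm (deriv Y a) ^ 2) * vdot (Y a - Z b) (V1 - V2) := by
    have : vdot (Y a - Z b) (V1 - V2) = vdot (Y a - Z b) V1 - vdot (Y a - Z b) V2 := by
      simp [vdot]; ring
    rw [this]; linarith
  exact nonneg_of_mul_nonneg_right h5 (by positivity)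


lemma csf_red {X : ℝ → ℝ × ℝ} (h : Function.Periodic X (2 * π)) (φ : ℝ) :
    ∃ φ' ∈ Icc 0 (2 * π), X φ = X φ' := by
  obtain ⟨y, hy, h2⟩ := h.exists_mem_Ico₀ (by positivity) φ
  exact ⟨y, Ico_subset_Icc_self hy, h2⟩

lemma csf_avoid (Y Z : ℝ → ℝ → ℝ × ℝ) (t₁ : ℝ)
    (hY : ∀ t ∈ Icc 0 t₁, IsSmoothClosedCurve (Y t))
    (hZ : ∀ t ∈ Icc 0 t₁, IsSmoothClosedCurve (Z t))
    (hYc : ContinuousOn (fun p : ℝ × ℝ => Y p.1 p.2) (Icc 0 t₁ ×ˢ univ))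
    (hZc : ContinuousOn (fun p : ℝ × ℝ => Z p.1 p.2) (Icc 0 t₁ ×ˢ univ))
    (hYf : ∀ t ∈ Ioc 0 t₁, ∀ φ, ∃ α : ℝ, HasDerivAt (fun τ => Y τ φ)
      (α • unitTangent (Y t) φ + curv (Y t) φ • innerNormal (Y t) φ) t)
    (hZf : ∀ t ∈ Ioc 0 t₁, ∀ φ, ∃ α : ℝ, HasDerivAt (fun τ => Z τ φ)
      (α • unitTangent (Z t) φ + curv (Z t) φ • innerNormal (Z t) φ) t)
    (h0 : ∀ φ ψ, Y 0 φ ≠ Z 0 ψ) :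
    ∀ t ∈ Icc 0 t₁, ∀ φ ψ, Y t φ ≠ Z t ψ := by
  intro t ht φ ψ
  have h01 : (0:ℝ) ∈ Icc 0 t₁ := ⟨le_rfl, ht.1.trans ht.2⟩
  set K : Set (ℝ × ℝ) := Icc 0 (2 * π) ×ˢ Icc 0 (2 * π) with hKdef
  have hK : IsCompact K := isCompact_Icc.prod isCompact_Icc
  set f : ℝ → ℝ × ℝ → ℝ := fun t x => vdot (Y t x.1 - Z t x.2) (Y t x.1 - Z t x.2) with hf
  have hne : K.Nonempty := ⟨(0, 0), by simp [hKdef]; positivity⟩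
  have hc : ContinuousOn (fun p : ℝ × (ℝ × ℝ) => f p.1 p.2) (Icc 0 t₁ ×ˢ K) := by
    have h1 : ContinuousOn (fun p : ℝ × (ℝ × ℝ) => Y p.1 p.2.1) (Icc 0 t₁ ×ˢ K) :=
      hYc.comp (f := fun p : ℝ × (ℝ × ℝ) => (p.1, p.2.1)) (by fun_prop)
        (fun p hp => ⟨hp.1, mem_univ _⟩)
    have h2 : ContinuousOn (fun p : ℝ × (ℝ × ℝ) => Z p.1 p.2.2) (Icc 0 t₁ ×ˢ K) :=
      hZc.comp (f := fun p : ℝ × (ℝ × ℝ) => (p.1, p.2.2)) (by fun_prop)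
        (fun p hp => ⟨hp.1, mem_univ _⟩)
    have h3 := h1.sub h2
    simp only [hf, vdot]
    exact (h3.fst.mul h3.fst).add (h3.snd.mul h3.snd)
  have hc0 : ContinuousOn (f 0) K :=
    hc.comp (f := fun x : ℝ × ℝ => ((0:ℝ), x)) (by fun_prop) (fun x hx => ⟨h01, hx⟩)
  obtain ⟨x0, hx0, hmin⟩ := hK.exists_isMinOn hne hc0
  have hpos : 0 < f 0 x0 := by
    have := vnorm_pos (sub_ne_zero.2 (h0 x0.1 x0.2))
    have h2 := vnorm_sq (Y 0 x0.1 - Z 0 x0.2)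
    simp only [hf, vdot]
    nlinarith
  have key := csf_max_principle K hK f t₁ (f 0 x0) hc (fun x hx => hmin hx) (by
    intro s hs x hx hxm _
    have hs' : s ∈ Icc 0 t₁ := ⟨hs.1.le, hs.2⟩
    obtain ⟨α, hα⟩ := hYf s hs x.1
    obtain ⟨β, hβ⟩ := hZf s hs x.2
    have h1 := csf_fst (hα.sub hβ)
    have h2 := csf_snd (hα.sub hβ)
    refine ⟨_, ?_, (h1.mul h1).add (h2.mul h2)⟩
    · have := csf_avoid_pointwise (Y s) (Z s) (hY s hs').smooth (hZ s hs').smooth x.1 x.2 α β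
        ((hY s hs').regular _) ((hZ s hs').regular _) (by
          intro a b
          obtain ⟨a', ha', ha⟩ := csf_red (hY s hs').periodic a
          obtain ⟨b', hb', hb⟩ := csf_red (hZ s hs').periodic b
          rw [ha, hb]
          exact hxm (a', b') ⟨ha', hb'⟩)
      simp only [vdot] at this
      simp only [Pi.sub_apply] at this ⊢
      linarith)
  obtain ⟨a', ha', ha⟩ := csf_red (hY t ht).periodic φ
  obtain ⟨b', hb', hb⟩ := csf_red (hZ t ht).periodic ψ
  rw [ha, hb]
  intro heq
  have := key t ht (a', b') ⟨ha', hb'⟩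
  simp only [hf, heq] at this
  simp [vdot] at this
  simp only [hf, vdot] at hpos
  simp at hpos
  linarith

lemma csf_star {X : ℝ → ℝ × ℝ} (hX : IsSmoothClosedCurve X) (φ : ℝ) :
    vdet (X φ - 0) (unitTangent X φ) = vdet (X φ) (deriv X φ) / vnorm (deriv X φ) := by
  have := vnorm_pos (hX.regular φ)
  simp only [vdet, unitTangent, sub_zero, Prod.smul_fst, Prod.smul_snd, smul_eq_mul]
  field_simp

lemma csf_star_pos {X : ℝ → ℝ × ℝ} (hX : IsSmoothClosedCurve X) (hs : StarShapedWrt X 0) (φ : ℝ) :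
    0 < vdet (X φ) (deriv X φ) := by
  have h := hs φ
  rw [csf_star hX] at h
  have := vnorm_pos (hX.regular φ)
  exact (div_pos_iff_of_pos_right this).1 h

lemma csf_ang {a b : ℝ} (hc : cos a = cos b) (hs : sin a = sin b) :
    ∃ n : ℤ, a = b + n * (2 * π) := by
  have : cos (a - b) = 1 := by
    rw [cos_sub, hc, hs]; nlinarith [sin_sq_add_cos_sq b]
  obtain ⟨n, hn⟩ := (cos_eq_one_iff _).1 this
  exact ⟨n, by linarith⟩

lemma csf_inj {X : ℝ → ℝ × ℝ} (hp : Function.Periodic X (2 * π)) (he : IsEmbeddedCurve X)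
    {a b : ℝ} (h : X a = X b) : ∃ n : ℤ, a = b + n * (2 * π) := by
  have hpi : (0:ℝ) < 2 * π := by positivity
  have h1 := toIcoMod_mem_Ico hpi 0 a
  have h2 := toIcoMod_mem_Ico hpi 0 b
  rw [zero_add] at h1 h2
  have e1 : X (toIcoMod hpi 0 a) = X a := by
    rw [← self_sub_toIcoDiv_zsmul]; exact hp.sub_zsmul_eq _
  have e2 : X (toIcoMod hpi 0 b) = X b := by
    rw [← self_sub_toIcoDiv_zsmul]; exact hp.sub_zsmul_eq _
  have h3 := he h1 h2 (by rw [e1, e2, h])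
  rw [← self_sub_toIcoDiv_zsmul, ← self_sub_toIcoDiv_zsmul] at h3
  refine ⟨toIcoDiv hpi 0 a - toIcoDiv hpi 0 b, ?_⟩
  simp only [zsmul_eq_mul] at h3
  push_cast
  linarith

lemma csf_polar {X : ℝ → ℝ × ℝ} (hX : IsSmoothClosedCurve X) (he : IsEmbeddedCurve X)
    (hs : StarShapedWrt X 0) : ∃ Θ : ℝ → ℝ, Continuous Θ ∧ StrictMono Θ ∧
      Function.Surjective Θ ∧ (∀ φ, Θ (φ + 2 * π) = Θ φ + 2 * π) ∧
      ∀ φ, X φ = vnorm (X φ) • (cos (Θ φ), sin (Θ φ)) := by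
  have hpi : (0:ℝ) < 2 * π := by positivity
  have hP := csf_star_pos hX hs
  have hd := csf_d1 hX.smooth
  have hne : ∀ φ, X φ ≠ 0 := fun φ h0 => by
    have := hP φ; rw [h0] at this; simp [vdet] at this
  have hr : ∀ φ, 0 < vnorm (X φ) := fun φ => vnorm_pos (hne φ)
  have hXc : Continuous X := hX.smooth.continuous
  have hX'c : Continuous (deriv X) := (csf_deriv_smooth hX.smooth).continuous
  have hX'p : Function.Periodic (deriv X) (2 * π) := fun φ => by
    rw [← deriv_comp_add_const]
    congr 1
    exact funext hX.periodic
  have hrc : Continuous (fun φ => vnorm (X φ)) := vnorm_cont.comp hXc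
  set F : ℝ → ℝ := fun φ => vdet (X φ) (deriv X φ) / vnorm (X φ) ^ 2 with hF
  have hFc : Continuous F := by
    refine Continuous.div ?_ (hrc.pow 2) (fun φ => (pow_pos (hr φ) 2).ne')
    unfold vdet
    fun_prop
  have hFpos : ∀ φ, 0 < F φ := fun φ => div_pos (hP φ) (pow_pos (hr φ) 2)
  have hFp : ∀ φ, F (φ + 2 * π) = F φ := fun φ => by
    simp only [hF, hX.periodic φ, hX'p φ]
  set z0 : ℂ := ⟨(X 0).1, (X 0).2⟩ with hz0
  set Θ : ℝ → ℝ := fun φ => Complex.arg z0 + ∫ s in (0:ℝ)..φ, F s with hΘ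
  have hΘd : ∀ φ, HasDerivAt Θ (F φ) φ := fun φ =>
    (intervalIntegral.integral_hasDerivAt_right (hFc.intervalIntegrable _ _)
      (hFc.stronglyMeasurableAtFilter _ _) hFc.continuousAt).const_add _
  have hΘc : Continuous Θ := continuous_iff_continuousAt.2 fun φ => (hΘd φ).continuousAt
  have hΘm : StrictMono Θ := strictMono_of_deriv_pos fun φ => by
    rw [(hΘd φ).deriv]; exact hFpos φ
  have hz0n : ‖z0‖ = vnorm (X 0) := by
    rw [Complex.norm_eq_sqrt_sq_add_sq]; rfl
  have hΘ0 : Θ 0 = Complex.arg z0 := by simp [hΘ]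
  have hrd : ∀ φ, HasDerivAt (fun s => vnorm (X s)) (vdot (X φ) (deriv X φ) / vnorm (X φ)) φ := by
    intro φ
    have h1 := csf_fst (hd φ)
    have h2 := csf_snd (hd φ)
    have h3 := ((h1.pow 2).add (h2.pow 2)).sqrt (by
      have := vnorm_sq (X φ)
      have h5 := hr φ
      simp only [Pi.add_apply, Pi.pow_apply]
      rw [← this]; positivity)
    refine h3.congr_deriv ?_
    have : √((X φ).1 ^ 2 + (X φ).2 ^ 2) = vnorm (X φ) := rfl
    simp only [Pi.add_apply, Pi.pow_apply, this]
    have := hr φ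
    simp only [vdot]
    field_simp
    simp
    ring
  have hpol : ∀ φ, X φ = vnorm (X φ) • (cos (Θ φ), sin (Θ φ)) := by
    have hA : ∀ φ, HasDerivAt (fun s => ((X s).1 * cos (Θ s) + (X s).2 * sin (Θ s)) / vnorm (X s))
        0 φ := by
      intro φ
      have h1 := csf_fst (hd φ)
      have h2 := csf_snd (hd φ)
      refine (((h1.mul (hΘd φ).cos).add (h2.mul (hΘd φ).sin)).div (hrd φ) (hr φ).ne').congr_deriv ?_
      have hsq := vnorm_sq (X φ)
      have h5 := hr φ
      simp only [hF, vdot, vdet, Pi.add_apply, Pi.mul_apply]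
      generalize vnorm (X φ) = l at *
      generalize cos (Θ φ) = c at *
      generalize sin (Θ φ) = s at *
      generalize deriv X φ = v at *
      generalize X φ = x at *
      field_simp
      rw [hsq]
      ring
    have hB : ∀ φ, HasDerivAt (fun s => ((X s).2 * cos (Θ s) - (X s).1 * sin (Θ s)) / vnorm (X s))
        0 φ := by
      intro φ
      have h1 := csf_fst (hd φ)
      have h2 := csf_snd (hd φ)
      refine (((h2.mul (hΘd φ).cos).sub (h1.mul (hΘd φ).sin)).div (hrd φ) (hr φ).ne').congr_deriv ?_
      have hsq := vnorm_sq (X φ)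
      have h5 := hr φ
      simp only [hF, vdot, vdet, Pi.sub_apply, Pi.mul_apply]
      generalize vnorm (X φ) = l at *
      generalize cos (Θ φ) = c at *
      generalize sin (Θ φ) = s at *
      generalize deriv X φ = v at *
      generalize X φ = x at *
      field_simp
      rw [hsq]
      ring
    have hx1 : (X 0).1 = vnorm (X 0) * cos (Θ 0) := by
      rw [hΘ0, ← hz0n, Complex.norm_mul_cos_arg]
    have hx2 : (X 0).2 = vnorm (X 0) * sin (Θ 0) := by
      rw [hΘ0, ← hz0n, Complex.norm_mul_sin_arg]
    intro φ
    have hAc := is_const_of_deriv_eq_zero (fun φ => (hA φ).differentiableAt)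
      (fun φ => (hA φ).deriv) φ 0
    have hBc := is_const_of_deriv_eq_zero (fun φ => (hB φ).differentiableAt)
      (fun φ => (hB φ).deriv) φ 0
    have hA0 : ((X 0).1 * cos (Θ 0) + (X 0).2 * sin (Θ 0)) / vnorm (X 0) = 1 := by
      rw [div_eq_one_iff_eq (hr 0).ne']
      rw [hx1, hx2]
      linear_combination vnorm (X 0) * sin_sq_add_cos_sq (Θ 0)
    have hB0 : ((X 0).2 * cos (Θ 0) - (X 0).1 * sin (Θ 0)) / vnorm (X 0) = 0 := by
      rw [hx1, hx2]
      ring_nf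
    rw [hA0, div_eq_one_iff_eq (hr φ).ne'] at hAc
    rw [hB0, div_eq_zero_iff, or_iff_left (hr φ).ne'] at hBc
    ext
    · simp only [Prod.smul_fst, smul_eq_mul]
      linear_combination cos (Θ φ) * hAc - sin (Θ φ) * hBc - (X φ).1 * sin_sq_add_cos_sq (Θ φ)
    · simp only [Prod.smul_snd, smul_eq_mul]
      linear_combination sin (Θ φ) * hAc + cos (Θ φ) * hBc - (X φ).2 * sin_sq_add_cos_sq (Θ φ)
  obtain ⟨c, hc⟩ : ∃ c, ∀ φ, Θ (φ + 2 * π) = Θ φ + c := by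
    refine ⟨Θ (0 + 2 * π) - Θ 0, fun φ => ?_⟩
    have hD : ∀ φ, HasDerivAt (fun s => Θ (s + 2 * π) - Θ s) 0 φ := fun φ => by
      refine (((hΘd (φ + 2 * π)).comp_add_const φ (2 * π)).sub (hΘd φ)).congr_deriv ?_
      rw [hFp, sub_self]
    have := is_const_of_deriv_eq_zero (fun φ => (hD φ).differentiableAt)
      (fun φ => (hD φ).deriv) φ 0
    linarith
  have hcpos : 0 < c := by
    have h1 := hc 0
    have h2 := hΘm (show (0:ℝ) < 0 + 2 * π by linarith)
    linarith
  have hcz : ∀ (n : ℕ) φ, Θ (φ + n * (2 * π)) = Θ φ + n * c := by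
    intro n
    induction n with
    | zero => simp
    | succ n ih =>
      intro φ
      have : φ + ((n + 1 : ℕ) : ℝ) * (2 * π) = (φ + n * (2 * π)) + 2 * π := by push_cast; ring
      rw [this, hc, ih]; push_cast; ring
  have hsurj : Function.Surjective Θ := by
    intro θ
    obtain ⟨n, hn⟩ := exists_nat_gt (|θ - Θ 0| / c)
    rw [div_lt_iff₀ hcpos] at hn
    have h1 := hcz n 0
    have h2 := hcz n (-(n * (2 * π)))
    rw [neg_add_cancel] at h2
    have h3 := abs_lt.1 hn
    have := intermediate_value_Icc (a := -(n * (2 * π))) (b := 0 + n * (2 * π)) (by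
      have : 0 ≤ (n:ℝ) * (2 * π) := by positivity
      linarith) hΘc.continuousOn
    obtain ⟨x, -, hx⟩ := this (show θ ∈ Icc _ _ from ⟨by linarith, by linarith⟩)
    exact ⟨x, hx⟩
  have hXeq : ∀ {a b : ℝ}, Θ a = Θ b + 2 * π → vnorm (X a) = vnorm (X b) → X a = X b := by
    intro a b h1 h2
    rw [hpol a, hpol b, h1, h2, cos_add_two_pi, sin_add_two_pi]
  have hc2 : c = 2 * π := by
    have h1 := hpol (0 + 2 * π)
    rw [hX.periodic 0, hc 0] at h1
    have h2 := hpol 0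
    rw [h1] at h2
    have h3 := (Prod.ext_iff.1 h2)
    simp only [Prod.smul_fst, Prod.smul_snd, smul_eq_mul] at h3
    rw [← h1] at h3
    have hr0 := (hr 0).ne'
    obtain ⟨k, hk⟩ := csf_ang (mul_left_cancel₀ hr0 h3.1) (mul_left_cancel₀ hr0 h3.2)
    have hkc : c = k * (2 * π) := by linarith
    have hk0 : (0:ℝ) < k := by
      by_contra! hh
      nlinarith
    have hk1 : 1 ≤ k := by exact_mod_cast hk0
    rcases hk1.lt_or_eq with hk2 | hk2
    · exfalso
      have hk3 : (2:ℝ) ≤ k := by exact_mod_cast hk2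
      have hc4 : 2 * π < c := by nlinarith
      let e := (hΘm.orderIsoOfSurjective Θ hsurj)
      have hee : ∀ y, Θ (e.symm y) = y := fun y => e.apply_symm_apply y
      have hes : ∀ y, e.symm (Θ y) = y := fun y => e.symm_apply_apply y
      have hec : Continuous e.symm := e.symm.toHomeomorph.continuous
      obtain ⟨m, hm, hmax⟩ := isCompact_Icc.exists_isMaxOn (s := Icc 0 (2 * π))
        ⟨0, le_rfl, hpi.le⟩ hrc.continuousOn
      have hmax' : ∀ φ, vnorm (X φ) ≤ vnorm (X m) := fun φ => by
        obtain ⟨y, hy, h⟩ := csf_red hX.periodic φ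
        rw [h]; exact hmax hy
      have hcont : Continuous (fun φ => vnorm (X (e.symm (Θ φ + 2 * π))) - vnorm (X φ)) :=
        (hrc.comp (hec.comp (hΘc.add continuous_const))).sub hrc
      obtain ⟨φ, hφ⟩ := mem_range_of_exists_le_of_exists_ge hcont
        (c := 0) ⟨m, by linarith [hmax' (e.symm (Θ m + 2 * π))]⟩
        ⟨e.symm (Θ m - 2 * π), by
          rw [hee, sub_add_cancel, hes]
          linarith [hmax' (e.symm (Θ m - 2 * π))]⟩
      simp only at hφ
      have heq := hXeq (a := e.symm (Θ φ + 2 * π)) (b := φ) (hee _) (by linarith)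
      obtain ⟨n, hn⟩ := csf_inj hX.periodic he heq
      have hlt : φ < e.symm (Θ φ + 2 * π) := hΘm.lt_iff_lt.1 (by rw [hee]; linarith)
      have hlt2 : e.symm (Θ φ + 2 * π) < φ + 2 * π :=
        hΘm.lt_iff_lt.1 (by rw [hee, hc]; linarith)
      rw [hn] at hlt hlt2
      have a1 : (0:ℝ) < n := by
        by_contra! hh
        nlinarith
      have a2 : (n:ℝ) < 1 := by
        by_contra! hh
        nlinarith
      have a3 : 0 < n := by exact_mod_cast a1
      have a4 : n < 1 := by exact_mod_cast a2
      omega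
    · rw [hkc, ← hk2]; simp
  exact ⟨Θ, hΘc, hΘm, hsurj, fun φ => by rw [hc, hc2], hpol⟩


lemma csf_slice {Y : ℝ → ℝ → ℝ × ℝ} {X₀ : ℝ → ℝ × ℝ} {T : ℝ}
    (hsol : IsCSFSolutionOn Y X₀ (Ico 0 T)) {t : ℝ} (ht : t ∈ Ico 0 T) (φ : ℝ) :
    deriv (Y t) φ = fderivWithin ℝ (fun p : ℝ × ℝ => Y p.1 p.2) (Ico 0 T ×ˢ univ) (t, φ) (0, 1) := by
  have h1 := (hsol.smooth.differentiableOn (by simp) (t, φ) ⟨ht, mem_univ _⟩).hasFDerivWithinAt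
  have h2 : HasDerivWithinAt (fun s : ℝ => (t, s)) ((0:ℝ), (1:ℝ)) univ φ :=
    ((hasDerivAt_const φ t).prodMk (hasDerivAt_id φ)).hasDerivWithinAt
  have h3 := h1.comp_hasDerivWithinAt φ h2 (fun s _ => ⟨ht, mem_univ _⟩)
  rw [hasDerivWithinAt_univ] at h3
  exact h3.deriv

lemma csf_deriv_cont {Y : ℝ → ℝ → ℝ × ℝ} {X₀ : ℝ → ℝ × ℝ} {T : ℝ}
    (hsol : IsCSFSolutionOn Y X₀ (Ico 0 T)) :
    ContinuousOn (fun p : ℝ × ℝ => deriv (Y p.1) p.2) (Ico 0 T ×ˢ univ) := by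
  have hu : UniqueDiffOn ℝ (Ico (0:ℝ) T ×ˢ (univ : Set ℝ)) :=
    (uniqueDiffOn_Ico 0 T).prod uniqueDiffOn_univ
  have h1 := hsol.smooth.continuousOn_fderivWithin hu (by simp)
  have h2 : ContinuousOn (fun p : ℝ × ℝ =>
    fderivWithin ℝ (fun p : ℝ × ℝ => Y p.1 p.2) (Ico 0 T ×ˢ univ) p (0, 1)) (Ico 0 T ×ˢ univ) :=
    h1.clm_apply continuousOn_const
  exact h2.congr fun p hp => csf_slice hsol hp.1 p.2

lemma csf_flow {Y : ℝ → ℝ → ℝ × ℝ} {X₀ : ℝ → ℝ × ℝ} {T : ℝ}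
    (hsol : IsCSFSolutionOn Y X₀ (Ico 0 T)) {t : ℝ} (ht : t ∈ Ioo 0 T) (φ : ℝ) :
    ∃ α : ℝ, HasDerivAt (fun τ => Y τ φ)
      (α • unitTangent (Y t) φ + curv (Y t) φ • innerNormal (Y t) φ) t := by
  obtain ⟨α, hα⟩ := hsol.flow
  exact ⟨α t φ, (hα t (Ioo_subset_Ico_self ht) φ).hasDerivAt (Ico_mem_nhds ht.1 ht.2)⟩

lemma csf_mixed {Y : ℝ → ℝ → ℝ × ℝ} {X₀ : ℝ → ℝ × ℝ} {T : ℝ}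
    (hsol : IsCSFSolutionOn Y X₀ (Ico 0 T)) {t : ℝ} (ht : t ∈ Ioo 0 T) (φ : ℝ) :
    ∃ W : ℝ × ℝ, HasDerivAt (fun τ => deriv (Y τ) φ) W t ∧
      HasDerivAt (fun ψ => deriv (fun τ => Y τ ψ) t) W φ := by
  set u : ℝ × ℝ → ℝ × ℝ := fun p => Y p.1 p.2 with hu
  have hcd : ∀ p : ℝ × ℝ, p.1 ∈ Ioo 0 T → ContDiffAt ℝ (⊤ : ℕ∞) u p := fun p hp =>
    hsol.smooth.contDiffAt (prod_mem_nhds (Ico_mem_nhds hp.1 hp.2) univ_mem)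
  have hdu : ∀ p : ℝ × ℝ, p.1 ∈ Ioo 0 T → HasFDerivAt u (fderiv ℝ u p) p := fun p hp =>
    ((hcd p hp).differentiableAt (by simp)).hasFDerivAt
  have e1 : ∀ τ ∈ Ioo 0 T, ∀ ψ, deriv (Y τ) ψ = fderiv ℝ u (τ, ψ) (0, 1) := fun τ hτ ψ =>
    ((hdu (τ, ψ) hτ).comp_hasDerivAt ψ
      ((hasDerivAt_const ψ τ).prodMk (hasDerivAt_id ψ))).deriv
  have e2 : ∀ τ ∈ Ioo 0 T, ∀ ψ, deriv (fun τ => Y τ ψ) τ = fderiv ℝ u (τ, ψ) (1, 0) :=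
    fun τ hτ ψ => by
      have h : HasDerivAt (fun τ : ℝ => (τ, ψ)) ((1:ℝ), (0:ℝ)) τ :=
        (hasDerivAt_id τ).prodMk (hasDerivAt_const τ ψ)
      have h2 : HasDerivAt (fun τ => Y τ ψ) (fderiv ℝ u (τ, ψ) (1, 0)) τ :=
        HasFDerivAt.comp_hasDerivAt (l := u) τ (hdu (τ, ψ) hτ) h
      exact h2.deriv
  have hd2 : HasFDerivAt (fderiv ℝ u) (fderiv ℝ (fderiv ℝ u) (t, φ)) (t, φ) := by
    have : ContDiffAt ℝ 1 (fderiv ℝ u) (t, φ) :=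
      (hcd (t, φ) ht).fderiv_right (m := 1) (by norm_cast)
    exact (this.differentiableAt (by simp)).hasFDerivAt
  have hsymm : IsSymmSndFDerivAt ℝ u (t, φ) :=
    (hcd (t, φ) ht).isSymmSndFDerivAt (by simp; norm_cast)
  refine ⟨fderiv ℝ (fderiv ℝ u) (t, φ) (1, 0) (0, 1), ?_, ?_⟩
  · have h1 : HasDerivAt (fun τ : ℝ => fderiv ℝ u (τ, φ))
        (fderiv ℝ (fderiv ℝ u) (t, φ) (1, 0)) t :=
      hd2.comp_hasDerivAt t ((hasDerivAt_id t).prodMk (hasDerivAt_const t φ))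
    have h2 := h1.clm_apply (hasDerivAt_const t ((0:ℝ), (1:ℝ)))
    simp only [map_zero, add_zero] at h2
    refine h2.congr_of_eventuallyEq ?_
    filter_upwards [Ioo_mem_nhds ht.1 ht.2] with τ hτ
    exact e1 τ hτ φ
  · have h1 : HasDerivAt (fun ψ : ℝ => fderiv ℝ u (t, ψ))
        (fderiv ℝ (fderiv ℝ u) (t, φ) (0, 1)) φ :=
      hd2.comp_hasDerivAt φ ((hasDerivAt_const φ t).prodMk (hasDerivAt_id φ))
    have h2 := h1.clm_apply (hasDerivAt_const φ ((1:ℝ), (0:ℝ)))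
    simp only [map_zero, add_zero] at h2
    rw [hsymm.eq (1, 0) (0, 1)]
    refine h2.congr_of_eventuallyEq ?_
    exact Eventually.of_forall fun ψ => e2 t ht ψ

lemma csf_cs (a b : ℝ × ℝ) : vdot a b ≤ vnorm a * vnorm b := by
  have h1 := vnorm_sq a
  have h2 := vnorm_sq b
  apply le_of_sq_le_sq _ (mul_nonneg (vnorm_nonneg a) (vnorm_nonneg b))
  rw [mul_pow, h1, h2]
  simp only [vdot]
  nlinarith [sq_nonneg (a.1 * b.2 - a.2 * b.1)]

lemma csf_det_static {X : ℝ → ℝ × ℝ} (hX : IsSmoothClosedCurve X) (φ₀ : ℝ)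
    (hP : 0 ≤ vdet (X φ₀) (deriv X φ₀))
    (hdot : vdot (X φ₀) (deriv X φ₀) ≠ 0)
    (hmin : ∀ φ, vdet (X φ₀) (deriv X φ₀) / vnorm (deriv X φ₀) ≤
      vdet (X φ) (deriv X φ) / vnorm (deriv X φ)) :
    vdet (deriv X φ₀) (deriv (deriv X) φ₀) = 0 ∧
    0 ≤ vdot (X φ₀) (deriv X φ₀) * vdet (deriv X φ₀) (deriv (deriv (deriv X)) φ₀) := by
  have hd1 := csf_d1 hX.smooth
  have hd2 := csf_d1 (csf_deriv_smooth hX.smooth)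
  have hd3 := csf_d1 (csf_deriv_smooth (csf_deriv_smooth hX.smooth))
  have l0 := vnorm_pos (hX.regular φ₀)
  have hsq := vnorm_sq (deriv X φ₀)
  set A := deriv X φ₀ with hA
  set P := vdet (X φ₀) A with hPd
  have key := csf_second_deriv
    (fun φ => vnorm A ^ 2 * vdet (X φ) (deriv X φ) - P * vdot A (deriv X φ))
    (fun φ => vnorm A ^ 2 * vdet (X φ) (deriv (deriv X) φ) - P * vdot A (deriv (deriv X) φ)) φ₀
    (vnorm A ^ 2 * (vdet A (deriv (deriv X) φ₀) + vdet (X φ₀) (deriv (deriv (deriv X)) φ₀)) -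
      P * vdot A (deriv (deriv (deriv X)) φ₀))
    (fun φ => by
      have a1 := csf_fst (hd1 φ)
      have a2 := csf_snd (hd1 φ)
      have b1 := csf_fst (hd2 φ)
      have b2 := csf_snd (hd2 φ)
      refine ((((a1.mul b2).sub (a2.mul b1)).const_mul (vnorm A ^ 2)).sub
        (((b1.const_mul A.1).add (b2.const_mul A.2)).const_mul P)).congr_deriv ?_
      simp only [vdet, vdot]
      ring)
    (by
      have a1 := csf_fst (hd1 φ₀)
      have a2 := csf_snd (hd1 φ₀)
      have b1 := csf_fst (hd3 φ₀)
      have b2 := csf_snd (hd3 φ₀)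
      refine ((((a1.mul b2).sub (a2.mul b1)).const_mul (vnorm A ^ 2)).sub
        (((b1.const_mul A.1).add (b2.const_mul A.2)).const_mul P)).congr_deriv ?_
      simp only [vdet, vdot]
      ring)
    (fun φ => by
      have e0 : vnorm A ^ 2 * vdet (X φ₀) (deriv X φ₀) - P * vdot A (deriv X φ₀) = 0 := by
        rw [← hA, ← hPd, hsq]; simp only [vdot]; ring
      have lφ := vnorm_pos (hX.regular φ)
      have h1 := hmin φ
      rw [div_le_div_iff₀ l0 lφ] at h1
      have h2 := mul_le_mul_of_nonneg_left (csf_cs A (deriv X φ)) hP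
      have h3 := mul_le_mul_of_nonneg_left h1 l0.le
      show vnorm A ^ 2 * vdet (X φ₀) (deriv X φ₀) - P * vdot A (deriv X φ₀) ≤ _
      rw [e0]
      nlinarith)
  obtain ⟨k1, k2⟩ := key
  have r1 : vdet A (deriv (deriv X) φ₀) = 0 := by
    have : vdot (X φ₀) A * vdet A (deriv (deriv X) φ₀) = 0 := by
      simp only [hsq] at k1
      rw [← k1, hPd]
      simp only [vdet, vdot]
      ring
    exact (mul_eq_zero.1 this).resolve_left hdot
  refine ⟨r1, ?_⟩
  rw [r1, hsq] at k2
  refine k2.trans_eq ?_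
  rw [hPd]
  simp only [vdet, vdot]
  ring

lemma csf_det_evolve {Y : ℝ → ℝ → ℝ × ℝ} {X₀ : ℝ → ℝ × ℝ} {T : ℝ}
    (hsol : IsCSFSolutionOn Y X₀ (Ico 0 T)) {t : ℝ} (ht : t ∈ Ioo 0 T) (φ₀ : ℝ)
    (hP : 0 ≤ vdet (Y t φ₀) (deriv (Y t) φ₀))
    (hdot : vdot (Y t φ₀) (deriv (Y t) φ₀) ≠ 0)
    (hmin : ∀ φ, vdet (Y t φ₀) (deriv (Y t) φ₀) / vnorm (deriv (Y t) φ₀) ≤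
      vdet (Y t φ) (deriv (Y t) φ) / vnorm (deriv (Y t) φ)) :
    ∃ d, 0 ≤ d ∧ HasDerivAt
      (fun τ => vdet (Y τ φ₀) (deriv (Y τ) φ₀) / vnorm (deriv (Y τ) φ₀)) d t := by
  have hX := hsol.curve t (Ioo_subset_Ico_self ht)
  obtain ⟨s1, s2⟩ := csf_det_static hX φ₀ hP hdot hmin
  obtain ⟨W, w1, w2⟩ := csf_mixed hsol ht φ₀
  have hd2 := csf_d1 (csf_deriv_smooth hX.smooth) φ₀
  have hd3 := csf_d1 (csf_deriv_smooth (csf_deriv_smooth hX.smooth)) φ₀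
  have hV : ∀ φ, vnorm (deriv (Y t) φ) ^ 2 * vdet (deriv (Y t) φ) (deriv (fun τ => Y τ φ) t) =
      vdet (deriv (Y t) φ) (deriv (deriv (Y t)) φ) := by
    intro φ
    obtain ⟨α, hα⟩ := csf_flow hsol ht φ
    rw [hα.deriv]
    have l0 := vnorm_pos (hX.regular φ)
    have hsq := vnorm_sq (deriv (Y t) φ)
    simp only [vdet, curv, innerNormal, unitTangent, Prod.fst_add, Prod.snd_add, Prod.smul_fst,
      Prod.smul_snd, smul_eq_mul]
    generalize vnorm (deriv (Y t) φ) = l at *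
    generalize deriv (deriv (Y t)) φ = B at *
    generalize deriv (Y t) φ = A at *
    field_simp
    linear_combination (-(A.1 * B.2 - A.2 * B.1)) * hsq
  have l0 := vnorm_pos (hX.regular φ₀)
  have hsq := vnorm_sq (deriv (Y t) φ₀)
  obtain ⟨α, hα⟩ := csf_flow hsol ht φ₀
  have hV0 := hV φ₀
  rw [s1] at hV0
  have hV0' := (mul_eq_zero.1 hV0).resolve_left (by positivity)
  rw [hα.deriv] at hV0'
  have hVW : vnorm (deriv (Y t) φ₀) ^ 2 * vdet (deriv (Y t) φ₀) W =
      vdet (deriv (Y t) φ₀) (deriv (deriv (deriv (Y t))) φ₀) := by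
    have a1 := csf_fst hd2
    have a2 := csf_snd hd2
    have b1 := csf_fst hd3
    have b2 := csf_snd hd3
    have c1 := csf_fst w2
    have c2 := csf_snd w2
    have hL := ((a1.mul a1).add (a2.mul a2)).mul ((a1.mul c2).sub (a2.mul c1))
    have hR := (a1.mul b2).sub (a2.mul b1)
    have heq := (hL.congr_of_eventuallyEq (Eventually.of_forall fun φ => by
      have h1 := hV φ
      rw [vnorm_sq] at h1
      simp only [vdet] at h1
      simp only [Pi.mul_apply, Pi.sub_apply, Pi.add_apply]
      rw [← h1]; ring)).unique hR
    simp only [Pi.mul_apply, Pi.sub_apply, Pi.add_apply] at heq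
    rw [hα.deriv] at heq
    rw [hsq]
    simp only [vdet] at heq s1 hV0' ⊢
    generalize (α • unitTangent (Y t) φ₀ + curv (Y t) φ₀ • innerNormal (Y t) φ₀) = V at *
    generalize deriv (deriv (deriv (Y t))) φ₀ = C at *
    generalize deriv (deriv (Y t)) φ₀ = B at *
    generalize deriv (Y t) φ₀ = A at *
    linear_combination heq - (3 * (A.1 * B.1 + A.2 * B.2)) * hV0' + (A.1 * V.1 + A.2 * V.2) * s1
  have y1 := csf_fst hα
  have y2 := csf_snd hα
  have x1 := csf_fst w1
  have x2 := csf_snd w1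
  have hn : HasDerivAt (fun τ => vnorm (deriv (Y τ) φ₀))
      (vdot (deriv (Y t) φ₀) W / vnorm (deriv (Y t) φ₀)) t := by
    have h3 := ((x1.pow 2).add (x2.pow 2)).sqrt (by
      simp only [Pi.add_apply, Pi.pow_apply]
      rw [← hsq]; positivity)
    refine h3.congr_deriv ?_
    have : √((deriv (Y t) φ₀).1 ^ 2 + (deriv (Y t) φ₀).2 ^ 2) = vnorm (deriv (Y t) φ₀) := rfl
    simp only [Pi.add_apply, Pi.pow_apply, this]
    simp only [vdot]
    field_simp
    simp
    ring
  refine ⟨_, ?_, ((y1.mul x2).sub (y2.mul x1)).div hn l0.ne'⟩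
  simp only [Pi.mul_apply, Pi.sub_apply]
  generalize (α • unitTangent (Y t) φ₀ + curv (Y t) φ₀ • innerNormal (Y t) φ₀) = V at *
  generalize deriv (deriv (deriv (Y t))) φ₀ = C at *
  generalize deriv (Y t) φ₀ = A at *
  generalize vnorm A = l at *
  generalize Y t φ₀ = x at *
  rw [← hVW] at s2
  simp only [vdot, vdet] at *
  have s3 : 0 ≤ (x.1 * A.1 + x.2 * A.2) * (A.1 * W.2 - A.2 * W.1) := by
    have : 0 ≤ l ^ 2 * ((x.1 * A.1 + x.2 * A.2) * (A.1 * W.2 - A.2 * W.1)) := by linarith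
    exact nonneg_of_mul_nonneg_right this (by positivity)
  have : ((V.1 * A.2 + x.1 * W.2 - (V.2 * A.1 + x.2 * W.1)) * l -
      (x.1 * A.2 - x.2 * A.1) * ((A.1 * W.1 + A.2 * W.2) / l)) / l ^ 2 =
      ((x.1 * A.1 + x.2 * A.2) * (A.1 * W.2 - A.2 * W.1)) / l ^ 3 := by
    field_simp
    linear_combination (x.1 * W.2 - x.2 * W.1) * hsq - l ^ 2 * hV0'
  rw [this]
  positivity


lemma csf_deriv_smul (μ : ℝ) {X : ℝ → ℝ × ℝ} (h : ContDiff ℝ (⊤ : ℕ∞) X) :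
    deriv (fun φ => μ • X φ) = fun φ => μ • deriv X φ :=
  funext fun φ => ((csf_d1 h φ).const_smul μ).deriv

lemma csf_scale {X : ℝ → ℝ × ℝ} (hX : IsSmoothClosedCurve X) {l : ℝ} (hl : 0 < l) :
    IsSmoothClosedCurve (fun φ => (-l) • X φ) ∧
    ∀ φ α, (-l) • (l ^ 2)⁻¹ • (α • unitTangent X φ + curv X φ • innerNormal X φ) =
      (α / l) • unitTangent (fun φ => (-l) • X φ) φ +
        curv (fun φ => (-l) • X φ) φ • innerNormal (fun φ => (-l) • X φ) φ := by
  have e1 := csf_deriv_smul (-l) hX.smooth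
  have e2 := csf_deriv_smul (-l) (csf_deriv_smooth hX.smooth)
  refine ⟨⟨hX.smooth.const_smul (-l), fun φ => by simp only [hX.periodic φ], fun φ => ?_⟩, ?_⟩
  · rw [e1]
    exact smul_ne_zero (by linarith [hl] : -l ≠ 0) (hX.regular φ)
  · intro φ α
    have l0 := vnorm_pos (hX.regular φ)
    have hn : vnorm ((-l) • deriv X φ) = l * vnorm (deriv X φ) := by
      unfold vnorm
      rw [show ((-l) • deriv X φ).1 ^ 2 + ((-l) • deriv X φ).2 ^ 2 =
        l ^ 2 * ((deriv X φ).1 ^ 2 + (deriv X φ).2 ^ 2) by simp; ring]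
      rw [Real.sqrt_mul (by positivity), Real.sqrt_sq hl.le]
    simp only [curv, innerNormal, unitTangent, e1, e2, hn]
    ext
    · simp [vdet]
      field_simp
    · simp [vdet]
      field_simp

lemma csf_polar_dir {X : ℝ → ℝ × ℝ} (hp : Function.Periodic X (2 * π)) {Θ : ℝ → ℝ}
    (hm : StrictMono Θ) (h2 : ∀ φ, Θ (φ + 2 * π) = Θ φ + 2 * π) {a b : ℝ}
    (hc : cos (Θ a) = cos (Θ b)) (hs : sin (Θ a) = sin (Θ b)) : X a = X b := by
  have hper : Function.Periodic (fun φ => Θ φ - φ) (2 * π) := fun φ => by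
    simp only [h2]; ring
  obtain ⟨n, hn⟩ := csf_ang hc hs
  have h3 : Θ (b + n * (2 * π)) - (b + n * (2 * π)) = Θ b - b := hper.int_mul n b
  have : a = b + n * (2 * π) := hm.injective (by linarith)
  rw [this]
  exact hp.int_mul n b

def csfE (θ : ℝ) : ℝ × ℝ := (cos θ, sin θ)

lemma csfE_pi (θ : ℝ) : csfE (θ + π) = - csfE θ := by
  simp [csfE]

lemma vnorm_smul_csfE {c : ℝ} (hc : 0 ≤ c) (θ : ℝ) : vnorm (c • csfE θ) = c := by
  unfold vnorm csfE
  simp only [Prod.smul_mk, smul_eq_mul]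
  rw [show (c * cos θ) ^ 2 + (c * sin θ) ^ 2 = c ^ 2 by
    linear_combination c ^ 2 * sin_sq_add_cos_sq θ]
  exact Real.sqrt_sq hc

lemma csf_smul_csfE_inj {c d θ η : ℝ} (hc : 0 < c) (hd : 0 < d) (h : c • csfE θ = d • csfE η) :
    c = d ∧ cos θ = cos η ∧ sin θ = sin η := by
  have h1 : c = d := by
    rw [← vnorm_smul_csfE hc.le θ, h, vnorm_smul_csfE hd.le]
  subst h1
  simp only [csfE, Prod.smul_mk, smul_eq_mul, Prod.mk.injEq] at h
  exact ⟨rfl, mul_left_cancel₀ hc.ne' h.1, mul_left_cancel₀ hc.ne' h.2⟩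

lemma csf_ray {X : ℝ → ℝ × ℝ} (hX : IsSmoothClosedCurve X) (he : IsEmbeddedCurve X)
    (hs : StarShapedWrt X 0) : ∃ ρ : ℝ → ℝ,
      (∀ θ, 0 < ρ θ ∧ ∃ φ ∈ Icc 0 (2 * π), X φ = ρ θ • csfE θ) ∧
      (∀ φ θ c, 0 < c → X φ = c • csfE θ → c = ρ θ) ∧
      (∀ φ, ∃ θ, X φ = ρ θ • csfE θ) := by
  obtain ⟨Θ, -, hm, hsurj, h2, hpol⟩ := csf_polar hX he hs
  have hne : ∀ φ, X φ ≠ 0 := fun φ h0 => by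
    have := csf_star_pos hX hs φ; rw [h0] at this; simp [vdet] at this
  choose g hg using hsurj
  have hA : ∀ φ θ c, 0 < c → X φ = c • csfE θ → c = vnorm (X (g θ)) := by
    intro φ θ c hc h
    have h3 := hpol φ
    have h4 := csf_smul_csfE_inj hc (vnorm_pos (hne φ)) (h.symm.trans h3)
    have h5 : X (g θ) = X φ := csf_polar_dir hX.periodic hm h2
      (by rw [hg]; exact h4.2.1) (by rw [hg]; exact h4.2.2)
    rw [h5]; exact h4.1
  refine ⟨fun θ => vnorm (X (g θ)), ?_, hA, ?_⟩
  · intro θ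
    refine ⟨vnorm_pos (hne _), ?_⟩
    obtain ⟨φ', hφ', h⟩ := csf_red hX.periodic (g θ)
    refine ⟨φ', hφ', ?_⟩
    rw [← h]
    conv_lhs => rw [hpol (g θ), hg]
    rfl
  · intro φ
    refine ⟨Θ φ, ?_⟩
    have h5 := hA φ (Θ φ) (vnorm (X φ)) (vnorm_pos (hne φ)) (hpol φ)
    have h6 : X φ = vnorm (X φ) • csfE (Θ φ) := hpol φ
    exact h6.trans (by simp only [← h5])

lemma csf_tend {Y : ℝ → ℝ → ℝ × ℝ} {I : Set ℝ}
    (hc : ContinuousOn (fun p : ℝ × ℝ => Y p.1 p.2) (I ×ˢ univ)) {ι : Type*} {l : Filter ι}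
    {a b : ι → ℝ} {t φ : ℝ} (ht : t ∈ I) (ha : Tendsto a l (nhds t)) (haI : ∀ᶠ i in l, a i ∈ I)
    (hb : Tendsto b l (nhds φ)) : Tendsto (fun i => Y (a i) (b i)) l (nhds (Y t φ)) := by
  have h1 := hc (t, φ) ⟨ht, mem_univ _⟩
  refine Tendsto.comp (g := fun p : ℝ × ℝ => Y p.1 p.2) h1 (f := fun i => (a i, b i)) ?_
  refine tendsto_nhdsWithin_iff.2 ⟨ha.prodMk_nhds hb, ?_⟩
  filter_upwards [haI] with i hi
  exact ⟨hi, mem_univ _⟩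

lemma csf_ray_cont {Y : ℝ → ℝ → ℝ × ℝ} {I : Set ℝ}
    (hc : ContinuousOn (fun p : ℝ × ℝ => Y p.1 p.2) (I ×ˢ univ)) (ρ : ℝ → ℝ → ℝ)
    (h1 : ∀ t ∈ I, ∀ θ, 0 < ρ t θ ∧ ∃ φ ∈ Icc 0 (2 * π), Y t φ = ρ t θ • csfE θ)
    (h2 : ∀ t ∈ I, ∀ φ θ c, 0 < c → Y t φ = c • csfE θ → c = ρ t θ)
    (h3 : ∀ t ∈ I, ∀ φ, Y t φ ≠ 0) :
    ContinuousOn (fun p : ℝ × ℝ => ρ p.1 p.2) (I ×ˢ univ) := by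
  rintro ⟨t, θ⟩ ⟨ht, -⟩
  simp only at ht
  choose! φ hφ using fun t ht θ => (h1 t ht θ).2
  refine (tendsto_iff_ultrafilter _ _ _).2 fun U hU => ?_
  have hUI : ∀ᶠ p in (U : Filter (ℝ × ℝ)), p ∈ I ×ˢ (univ : Set ℝ) := hU self_mem_nhdsWithin
  have hUn : Tendsto id (U : Filter (ℝ × ℝ)) (nhds (t, θ)) := hU.trans nhdsWithin_le_nhds
  have hU1 : Tendsto (fun p : ℝ × ℝ => p.1) U (nhds t) := hUn.fst_nhds
  have hU2 : Tendsto (fun p : ℝ × ℝ => p.2) U (nhds θ) := hUn.snd_nhds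
  obtain ⟨x, hx, hlim⟩ := (isCompact_Icc (a := (0:ℝ)) (b := 2 * π)).ultrafilter_le_nhds
    (U.map fun p : ℝ × ℝ => φ p.1 p.2) (le_principal_iff.2
      (hUI.mono fun p hp => (hφ p.1 hp.1 p.2).1 :
        ∀ᶠ p in (U : Filter (ℝ × ℝ)), φ p.1 p.2 ∈ Icc 0 (2 * π)))
  have hlim' : Tendsto (fun p : ℝ × ℝ => φ p.1 p.2) U (nhds x) := hlim
  have hY := csf_tend hc ht hU1 (hUI.mono fun p hp => hp.1) hlim'
  have hn : Tendsto (fun p : ℝ × ℝ => ρ p.1 p.2) U (nhds (vnorm (Y t x))) := by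
    refine ((vnorm_cont.tendsto _).comp hY).congr' ?_
    filter_upwards [hUI] with p hp
    simp only [Function.comp]
    rw [(hφ p.1 hp.1 p.2).2, vnorm_smul_csfE (h1 p.1 hp.1 p.2).1.le]
  have hE : Continuous csfE := by unfold csfE; fun_prop
  have hY2 : Tendsto (fun p : ℝ × ℝ => Y p.1 (φ p.1 p.2)) U
      (nhds (vnorm (Y t x) • csfE θ)) := by
    refine (hn.smul ((hE.tendsto θ).comp hU2)).congr' ?_
    filter_upwards [hUI] with p hp
    exact (hφ p.1 hp.1 p.2).2.symm
  have heq := tendsto_nhds_unique hY hY2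
  have := h2 t ht x θ _ (vnorm_pos (h3 t ht x)) heq
  show Tendsto _ _ (nhds (ρ t θ))
  rw [← this]
  exact hn

lemma csf_symm {Y : ℝ → ℝ → ℝ × ℝ} {X₀ : ℝ → ℝ × ℝ} {T : ℝ}
    (hsym₀ : CentroSymmetricWrt X₀ 0)
    (hsol : IsCSFSolutionOn Y X₀ (Ico 0 T))
    (hembt : ∀ t ∈ Ico (0:ℝ) T, IsEmbeddedCurve (Y t))
    {t₁ : ℝ} (ht₁ : t₁ ≤ T) (hstar : ∀ t ∈ Ico 0 t₁, StarShapedWrt (Y t) 0) :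
    ∀ t ∈ Ico 0 t₁, ∀ φ, ∃ ψ, Y t ψ = - Y t φ := by
  have hsub : Ico 0 t₁ ⊆ Ico 0 T := Ico_subset_Ico_right ht₁
  have hray := fun t (ht : t ∈ Ico 0 t₁) =>
    csf_ray (hsol.curve t (hsub ht)) (hembt t (hsub ht)) (hstar t ht)
  choose! ρ r1 r2 r3 using hray
  have hcY : ContinuousOn (fun p : ℝ × ℝ => Y p.1 p.2) (Ico 0 t₁ ×ˢ univ) :=
    hsol.smooth.continuousOn.mono (Set.prod_mono hsub le_rfl)
  have hne : ∀ t ∈ Ico 0 t₁, ∀ φ, Y t φ ≠ 0 := fun t ht φ h0 => by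
    have := csf_star_pos (hsol.curve t (hsub ht)) (hstar t ht) φ
    rw [h0] at this; simp [vdet] at this
  have hρ := csf_ray_cont hcY ρ r1 r2 hne
  intro t ht
  have h0m : (0:ℝ) ∈ Ico 0 t₁ := ⟨le_rfl, ht.1.trans_lt ht.2⟩
  have hs0 : ∀ φ, ∃ ψ, Y 0 ψ = - Y 0 φ := by
    intro φ
    have : - X₀ φ ∈ range X₀ := by
      rw [← hsym₀]
      exact ⟨X₀ φ, ⟨φ, rfl⟩, by simp⟩
    obtain ⟨ψ, hψ⟩ := this
    exact ⟨ψ, by rw [hsol.init, hsol.init, hψ]⟩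
  have hρ0 : ∀ θ, ρ 0 (θ + π) = ρ 0 θ := by
    intro θ
    obtain ⟨hp, φ, -, hφ⟩ := r1 0 h0m θ
    obtain ⟨ψ, hψ⟩ := hs0 φ
    symm
    refine r2 0 h0m ψ (θ + π) _ hp ?_
    rw [hψ, hφ, csfE_pi, smul_neg]
  have hlam : ∀ l : ℝ, 1 < l → ∀ θ, ρ t θ ≤ l * ρ (t / l ^ 2) (θ + π) := by
    intro l hl θ
    have hl0 : 0 < l := by linarith
    have hl2 : 1 < l ^ 2 := by nlinarith
    have hdiv : ∀ s ∈ Icc 0 t, s / l ^ 2 ∈ Icc 0 t := fun s hs =>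
      ⟨div_nonneg hs.1 (by positivity), (div_le_self hs.1 hl2.le).trans hs.2⟩
    have hI : ∀ s ∈ Icc 0 t, s ∈ Ico 0 t₁ := fun s hs => ⟨hs.1, hs.2.trans_lt ht.2⟩
    have hdis := csf_avoid Y (fun s φ => (-l) • Y (s / l ^ 2) φ) t
      (fun s hs => hsol.curve s (hsub (hI s hs)))
      (fun s hs => (csf_scale (hsol.curve _ (hsub (hI _ (hdiv s hs)))) hl0).1)
      (hcY.mono (Set.prod_mono hI le_rfl))
      (by
        have : ContinuousOn (fun p : ℝ × ℝ => Y (p.1 / l ^ 2) p.2) (Icc 0 t ×ˢ univ) :=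
          hcY.comp (f := fun p : ℝ × ℝ => (p.1 / l ^ 2, p.2)) (by fun_prop)
            (fun p hp => ⟨hI _ (hdiv _ hp.1), mem_univ _⟩)
        exact this.const_smul (-l))
      (fun s hs φ => csf_flow hsol ⟨hs.1, (hs.2.trans_lt ht.2).trans_le ht₁⟩ φ)
      (fun s hs φ => by
        have hs' := hdiv s ⟨hs.1.le, hs.2⟩
        obtain ⟨α, hα⟩ := csf_flow hsol (t := s / l ^ 2)
          ⟨div_pos hs.1 (by positivity), (hs'.2.trans_lt ht.2).trans_le ht₁⟩ φ
        refine ⟨α / l, ?_⟩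
        rw [← (csf_scale (hsol.curve _ (hsub (hI _ hs'))) hl0).2 φ α]
        have hd : HasDerivAt (fun s : ℝ => s / l ^ 2) ((l ^ 2)⁻¹) s := by
          simpa using (hasDerivAt_id s).div_const (l ^ 2)
        exact (hα.scomp s hd).const_smul (-l))
      (by
        intro φ ψ heq
        simp only [zero_div] at heq
        obtain ⟨ψ', hψ'⟩ := hs0 ψ
        obtain ⟨η, hη⟩ := r3 0 h0m ψ'
        have hpos := (r1 0 h0m η).1
        have := r2 0 h0m φ η (l * ρ 0 η) (by positivity) (by
          rw [heq, mul_smul, ← hη, hψ']; simp)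
        nlinarith)
    set q : ℝ × ℝ → ℝ := fun p => l * ρ (p.1 / l ^ 2) (p.2 + π) - ρ p.1 p.2 with hq
    have hqc : ContinuousOn q (Icc 0 t ×ˢ univ) := by
      have h1 : ContinuousOn (fun p : ℝ × ℝ => ρ (p.1 / l ^ 2) (p.2 + π)) (Icc 0 t ×ˢ univ) :=
        hρ.comp (f := fun p : ℝ × ℝ => (p.1 / l ^ 2, p.2 + π)) (by fun_prop)
          (fun p hp => ⟨hI _ (hdiv _ hp.1), mem_univ _⟩)
      exact (continuousOn_const.mul h1).sub (hρ.mono (Set.prod_mono hI le_rfl))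
    have hqne : ∀ p ∈ Icc 0 t ×ˢ (univ : Set ℝ), q p ≠ 0 := by
      rintro ⟨s, η⟩ ⟨hs, -⟩ h0
      simp only at hs
      obtain ⟨-, φ, -, hφ⟩ := r1 s (hI s hs) η
      obtain ⟨-, ψ, -, hψ⟩ := r1 _ (hI _ (hdiv s hs)) (η + π)
      refine hdis s hs φ ψ ?_
      simp only [hq] at h0
      rw [hφ, hψ, csfE_pi, smul_neg, smul_neg, neg_smul, neg_neg, smul_smul]
      congr 1
      linarith
    have hpc : IsPreconnected (Icc 0 t ×ˢ (univ : Set ℝ)) := isPreconnected_Icc.prod isPreconnected_univ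
    by_contra! hlt
    have hm0 : ((0:ℝ), θ) ∈ Icc 0 t ×ˢ (univ : Set ℝ) := ⟨⟨le_rfl, ht.1⟩, mem_univ _⟩
    have hmt : (t, θ) ∈ Icc 0 t ×ˢ (univ : Set ℝ) := ⟨⟨ht.1, le_rfl⟩, mem_univ _⟩
    have hq0 : 0 ≤ q (0, θ) := by
      simp only [hq, zero_div, hρ0]
      have := (r1 0 h0m θ).1
      nlinarith
    obtain ⟨p, hp, hp0⟩ := hpc.intermediate_value hmt hm0 hqc
      (show (0:ℝ) ∈ Icc _ _ from ⟨by simp only [hq]; linarith, hq0⟩)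
    exact hqne p hp hp0
  have hle : ∀ θ, ρ t θ ≤ ρ t (θ + π) := by
    intro θ
    have hcl : ContinuousWithinAt (fun l : ℝ => l * ρ (t / l ^ 2) (θ + π)) (Ici 1) 1 := by
      refine continuousWithinAt_id.mul ?_
      have := hρ (t / 1 ^ 2, θ + π) ⟨by simpa using ht, mem_univ _⟩
      refine ContinuousWithinAt.comp (f := fun l : ℝ => (t / l ^ 2, θ + π))
        (g := fun p : ℝ × ℝ => ρ p.1 p.2) (t := Ico 0 t₁ ×ˢ univ) (x := (1:ℝ)) this ?_ ?_
      · refine ContinuousAt.continuousWithinAt ?_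
        refine ContinuousAt.prodMk ?_ continuousAt_const
        exact continuousAt_const.div (by fun_prop) (by norm_num)
      · intro l hl
        have hl1 : (1:ℝ) ≤ l ^ 2 := by
          have : (1:ℝ) ≤ l := hl
          nlinarith
        exact ⟨⟨div_nonneg ht.1 (by positivity), (div_le_self ht.1 hl1).trans_lt ht.2⟩, mem_univ _⟩
    have h1 := hcl.mono_left (nhdsWithin_mono _ Ioi_subset_Ici_self)
    simp only [one_pow, div_one, one_mul] at h1
    refine ge_of_tendsto h1 ?_
    filter_upwards [self_mem_nhdsWithin] with l hl
    exact hlam l hl θ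
  intro φ
  obtain ⟨θ, hθ⟩ := r3 t ht φ
  have h2 : ρ t (θ + π + π) = ρ t θ := by
    obtain ⟨hp, x, -, hx⟩ := r1 t ht θ
    symm
    refine r2 t ht x _ _ hp ?_
    rw [csfE_pi, csfE_pi, neg_neg, hx]
  have h3 : ρ t (θ + π) = ρ t θ := le_antisymm (by rw [← h2]; exact hle _) (hle θ)
  obtain ⟨-, ψ, -, hψ⟩ := r1 t ht (θ + π)
  exact ⟨ψ, by rw [hψ, h3, csfE_pi, hθ, smul_neg]⟩

lemma csf_half {X : ℝ → ℝ × ℝ} (hX : IsSmoothClosedCurve X) (he : IsEmbeddedCurve X)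
    (hs : StarShapedWrt X 0) (hsym : ∀ φ, ∃ ψ, X ψ = - X φ) (φ₀ : ℝ) :
    ∃ ψ ∈ Icc φ₀ (φ₀ + 2 * π), X ψ = - X φ₀ ∧
      (∀ φ ∈ Icc ψ (φ₀ + 2 * π), ∃ φ' ∈ Icc φ₀ ψ, vnorm (X φ') = vnorm (X φ)) ∧
      (∀ φ ∈ Icc φ₀ ψ, ∃ φ' ∈ Icc ψ (φ₀ + 2 * π), vnorm (X φ') = vnorm (X φ)) := by
  obtain ⟨Θ, -, hm, hsurj, h2, hpol⟩ := csf_polar hX he hs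
  have hpi := pi_pos
  have hne : ∀ φ, X φ ≠ 0 := fun φ h0 => by
    have := csf_star_pos hX hs φ; rw [h0] at this; simp [vdet] at this
  have hn : ∀ v : ℝ × ℝ, vnorm (-v) = vnorm v := fun v => by simp [vnorm]
  have key : ∀ a b, Θ b = Θ a + π → X b = - X a := by
    intro a b hab
    obtain ⟨ψ, hψ⟩ := hsym a
    rw [← hψ]
    have h3 : vnorm (X ψ) • csfE (Θ ψ) = vnorm (X a) • csfE (Θ b) := by
      have e1 : vnorm (X ψ) • csfE (Θ ψ) = X ψ := (hpol ψ).symm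
      have e2 : vnorm (X a) • csfE (Θ a) = X a := (hpol a).symm
      rw [e1, hψ, hab, csfE_pi, smul_neg, e2]
    have h4 := csf_smul_csfE_inj (vnorm_pos (hne ψ)) (vnorm_pos (hne a)) h3
    exact csf_polar_dir hX.periodic hm h2 h4.2.1.symm h4.2.2.symm
  obtain ⟨ψ, hψ⟩ := hsurj (Θ φ₀ + π)
  refine ⟨ψ, ⟨hm.le_iff_le.1 (by linarith), hm.le_iff_le.1 (by rw [h2]; linarith)⟩,
    key _ _ hψ, ?_, ?_⟩
  · intro φ hφ
    obtain ⟨x, hx⟩ := hsurj (Θ φ - π)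
    have a1 := hm.monotone hφ.1
    have a2 := hm.monotone hφ.2
    rw [h2] at a2
    refine ⟨x, ⟨hm.le_iff_le.1 (by linarith), hm.le_iff_le.1 (by linarith)⟩, ?_⟩
    rw [key x φ (by linarith), hn]
  · intro φ hφ
    obtain ⟨x, hx⟩ := hsurj (Θ φ + π)
    have a1 := hm.monotone hφ.1
    have a2 := hm.monotone hφ.2
    refine ⟨x, ⟨hm.le_iff_le.1 (by linarith), hm.le_iff_le.1 (by rw [h2]; linarith)⟩, ?_⟩
    rw [key φ x hx, hn]

lemma csf_origin {Y : ℝ → ℝ → ℝ × ℝ} {X₀ : ℝ → ℝ × ℝ} {T : ℝ}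
    (hsym₀ : CentroSymmetricWrt X₀ 0)
    (hsol : IsCSFSolutionOn Y X₀ (Ico 0 T))
    (hembt : ∀ t ∈ Ico (0:ℝ) T, IsEmbeddedCurve (Y t))
    {t₁ : ℝ} (h0 : 0 < t₁) (ht₁ : t₁ < T) (hstar : ∀ t ∈ Ico 0 t₁, StarShapedWrt (Y t) 0) :
    ∀ φ, Y t₁ φ ≠ 0 := by
  intro φ₀ hφ₀
  have hpi := pi_pos
  have hsub : Ico 0 t₁ ⊆ Ico 0 T := Ico_subset_Ico_right ht₁.le
  have hm1 : t₁ ∈ Ico 0 T := ⟨h0.le, ht₁⟩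
  have hsymm := csf_symm hsym₀ hsol hembt ht₁.le hstar
  have hhalf := fun t (ht : t ∈ Ico 0 t₁) => csf_half (hsol.curve t (hsub ht))
    (hembt t (hsub ht)) (hstar t ht) (hsymm t ht) φ₀
  choose! ψ p1 p2 p3 p4 using hhalf
  have hcY := hsol.smooth.continuousOn
  set U : Ultrafilter ℝ := Ultrafilter.of (nhdsWithin t₁ (Iio t₁)) with hU
  have hUle : (U : Filter ℝ) ≤ nhdsWithin t₁ (Iio t₁) := Ultrafilter.of_le _
  have hUI : ∀ᶠ t in (U : Filter ℝ), t ∈ Ico 0 t₁ := hUle (Ico_mem_nhdsLT h0)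
  have hUI' : ∀ᶠ t in (U : Filter ℝ), t ∈ Ico 0 T := hUI.mono fun t ht => hsub ht
  have hUn : Tendsto (fun t : ℝ => t) U (nhds t₁) := hUle.trans nhdsWithin_le_nhds
  obtain ⟨x, hx, hlim⟩ := (isCompact_Icc (a := φ₀) (b := φ₀ + 2 * π)).ultrafilter_le_nhds
    (U.map ψ) (le_principal_iff.2
      (hUI.mono fun t ht => p1 t ht : ∀ᶠ t in (U : Filter ℝ), ψ t ∈ Icc φ₀ (φ₀ + 2 * π)))
  have hlim' : Tendsto ψ U (nhds x) := hlim
  have hx0 : Y t₁ x = 0 := by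
    have e1 := csf_tend hcY hm1 hUn hUI' hlim'
    have e2 := csf_tend hcY hm1 hUn hUI' (tendsto_const_nhds (x := φ₀))
    have e3 : Tendsto (fun t => Y t (ψ t)) U (nhds (- Y t₁ φ₀)) := by
      refine e2.neg.congr' ?_
      filter_upwards [hUI] with t ht
      exact (p2 t ht).symm
    rw [tendsto_nhds_unique e1 e3, hφ₀, neg_zero]
  have hcurve := hsol.curve t₁ hm1
  have hxx : x = φ₀ ∨ x = φ₀ + 2 * π := by
    obtain ⟨n, hn⟩ := csf_inj hcurve.periodic (hembt t₁ hm1) (hx0.trans hφ₀.symm)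
    rw [hn] at hx
    have a1 : (0:ℝ) ≤ n := by
      by_contra! hh
      nlinarith [hx.1]
    have a2 : (n:ℝ) ≤ 1 := by
      by_contra! hh
      nlinarith [hx.2]
    have a3 : 0 ≤ n := by exact_mod_cast a1
    have a4 : n ≤ 1 := by exact_mod_cast a2
    have : n = 0 ∨ n = 1 := by omega
    rcases this with h | h
    · left; rw [hn, h]; simp
    · right; rw [hn, h]; simp
  -- the antipodal midpoint is also at the origin: contradiction
  have hmid : Y t₁ (φ₀ + π) = 0 := by
    have fin : ∀ y : ℝ → ℝ, Y t₁ x = 0 → Tendsto y U (nhds x) →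
        (∀ᶠ t in (U : Filter ℝ), vnorm (Y t (y t)) = vnorm (Y t (φ₀ + π))) →
        Y t₁ (φ₀ + π) = 0 := by
      intro y hz hy hev
      have e1 := (vnorm_cont.tendsto _).comp (csf_tend hcY hm1 hUn hUI' hy)
      have e2 := (vnorm_cont.tendsto _).comp
        (csf_tend hcY hm1 hUn hUI' (tendsto_const_nhds (x := φ₀ + π)))
      have e3 := tendsto_nhds_unique (e1.congr' hev) e2
      by_contra hne
      have := vnorm_pos hne
      rw [← e3, hz] at this
      simp [vnorm] at this
    rcases hxx with h | h
    · have hev : ∀ᶠ t in (U : Filter ℝ), ψ t < φ₀ + π :=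
        hlim'.eventually (gt_mem_nhds (by linarith))
      have hex : ∀ t, ∃ y, (t ∈ Ico 0 t₁ ∧ ψ t < φ₀ + π) →
          (y ∈ Icc φ₀ (ψ t) ∧ vnorm (Y t y) = vnorm (Y t (φ₀ + π))) := by
        intro t
        by_cases hc : t ∈ Ico 0 t₁ ∧ ψ t < φ₀ + π
        · obtain ⟨y, hy, hy2⟩ := p3 t hc.1 (φ₀ + π) ⟨hc.2.le, by linarith⟩
          exact ⟨y, fun _ => ⟨hy, hy2⟩⟩
        · exact ⟨0, fun h => absurd h hc⟩
      choose y hy using hex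
      refine fin y hx0 ?_ ?_
      · refine tendsto_of_tendsto_of_tendsto_of_le_of_le'
          (g := fun _ => φ₀) (h := ψ) (by rw [h]; exact tendsto_const_nhds) hlim' ?_ ?_
        · filter_upwards [hUI, hev] with t h1 h2 using (hy t ⟨h1, h2⟩).1.1
        · filter_upwards [hUI, hev] with t h1 h2 using (hy t ⟨h1, h2⟩).1.2
      · filter_upwards [hUI, hev] with t h1 h2 using (hy t ⟨h1, h2⟩).2
    · have hev : ∀ᶠ t in (U : Filter ℝ), φ₀ + π < ψ t :=
        hlim'.eventually (lt_mem_nhds (by linarith))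
      have hex : ∀ t, ∃ y, (t ∈ Ico 0 t₁ ∧ φ₀ + π < ψ t) →
          (y ∈ Icc (ψ t) (φ₀ + 2 * π) ∧ vnorm (Y t y) = vnorm (Y t (φ₀ + π))) := by
        intro t
        by_cases hc : t ∈ Ico 0 t₁ ∧ φ₀ + π < ψ t
        · obtain ⟨y, hy, hy2⟩ := p4 t hc.1 (φ₀ + π) ⟨by linarith, hc.2.le⟩
          exact ⟨y, fun _ => ⟨hy, hy2⟩⟩
        · exact ⟨0, fun h => absurd h hc⟩
      choose y hy using hex
      refine fin y hx0 ?_ ?_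
      · refine tendsto_of_tendsto_of_tendsto_of_le_of_le'
          (g := ψ) (h := fun _ => φ₀ + 2 * π) hlim' (by rw [h]; exact tendsto_const_nhds) ?_ ?_
        · filter_upwards [hUI, hev] with t h1 h2 using (hy t ⟨h1, h2⟩).1.1
        · filter_upwards [hUI, hev] with t h1 h2 using (hy t ⟨h1, h2⟩).1.2
      · filter_upwards [hUI, hev] with t h1 h2 using (hy t ⟨h1, h2⟩).2
  obtain ⟨n, hn⟩ := csf_inj hcurve.periodic (hembt t₁ hm1) (hmid.trans hφ₀.symm)
  have a1 : (0:ℝ) < n := by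
    by_contra! hh
    nlinarith
  have a2 : (n:ℝ) < 1 := by
    by_contra! hh
    nlinarith
  have a3 : 0 < n := by exact_mod_cast a1
  have a4 : n < 1 := by exact_mod_cast a2
  omega


/-- Under the curve shortening flow, a smooth embedded solution starting from a
star-shaped, centrosymmetric curve stays star-shaped with respect to `O` on
`[0, A₀/(2π))`. -/
theorem csf_preserves_starshapedness
    (X₀ : ℝ → ℝ × ℝ) (Y : ℝ → ℝ → ℝ × ℝ)
    (hX₀ : IsSmoothClosedCurve X₀) (hemb : IsEmbeddedCurve X₀)
    (hstar₀ : StarShapedWrt X₀ 0) (hsym₀ : CentroSymmetricWrt X₀ 0)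
    (hsol : IsCSFSolutionOn Y X₀ (Set.Ico 0 (carea X₀ / (2 * π))))
    (hembt : ∀ t ∈ Set.Ico (0:ℝ) (carea X₀ / (2 * π)), IsEmbeddedCurve (Y t)) :
    ∀ t ∈ Set.Ico (0:ℝ) (carea X₀ / (2 * π)), StarShapedWrt (Y t) 0 := by
  set T := carea X₀ / (2 * π) with hT
  by_contra! hbad
  obtain ⟨tb, htb, hnb⟩ := hbad
  have hcY := hsol.smooth.continuousOn
  have hcD := csf_deriv_cont hsol
  set f : ℝ → ℝ → ℝ := fun t φ => vdet (Y t φ) (deriv (Y t) φ) / vnorm (deriv (Y t) φ) with hf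
  have hstarf : ∀ t ∈ Ico 0 T, (StarShapedWrt (Y t) 0 ↔ ∀ φ, 0 < f t φ) := by
    intro t ht
    unfold StarShapedWrt
    simp only [csf_star (hsol.curve t ht), hf]
  have hfc : ContinuousOn (fun p : ℝ × ℝ => f p.1 p.2) (Ico 0 T ×ˢ univ) := by
    refine ContinuousOn.div ?_ (vnorm_cont.comp_continuousOn hcD)
      (fun p hp => (vnorm_pos ((hsol.curve p.1 hp.1).regular p.2)).ne')
    simp only [vdet]
    exact (hcY.fst.mul hcD.snd).sub (hcY.snd.mul hcD.fst)
  have hfp : ∀ t ∈ Ico 0 T, Function.Periodic (f t) (2 * π) := by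
    intro t ht φ
    have hp := (hsol.curve t ht).periodic
    have hp' : deriv (Y t) (φ + 2 * π) = deriv (Y t) φ := by
      rw [← deriv_comp_add_const]
      congr 1
      exact funext hp
    simp only [hf, hp φ, hp']
  have hfred : ∀ t ∈ Ico 0 T, ∀ φ, ∃ φ' ∈ Icc 0 (2 * π), f t φ = f t φ' := by
    intro t ht φ
    obtain ⟨y, hy, h2⟩ := (hfp t ht).exists_mem_Ico₀ (by positivity) φ
    exact ⟨y, Ico_subset_Icc_self hy, h2⟩
  have hpi2 : (0:ℝ) ≤ 2 * π := by positivity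
  have hsubI : Icc 0 tb ⊆ Ico 0 T := fun s hs => ⟨hs.1, hs.2.trans_lt htb.2⟩
  -- the first time at which star-shapedness fails
  set B : Set (ℝ × ℝ) := (Icc 0 tb ×ˢ Icc 0 (2 * π)) ∩ (fun p : ℝ × ℝ => f p.1 p.2) ⁻¹' Iic 0 with hB
  have hBc : IsCompact B := by
    refine (isCompact_Icc.prod isCompact_Icc).of_isClosed_subset ?_ inter_subset_left
    exact (hfc.mono (Set.prod_mono hsubI (subset_univ _))).preimage_isClosed_of_isClosed
      (isClosed_Icc.prod isClosed_Icc) isClosed_Iic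
  have hBne : B.Nonempty := by
    rw [hstarf tb htb] at hnb
    push Not at hnb
    obtain ⟨φ, hφ⟩ := hnb
    obtain ⟨y, hy, h2⟩ := hfred tb htb φ
    exact ⟨(tb, y), ⟨⟨⟨htb.1, le_rfl⟩, hy⟩, by rw [h2] at hφ; exact hφ⟩⟩
  obtain ⟨⟨t₁, φ₁⟩, hmem, hmin⟩ := hBc.exists_isMinOn hBne
    (continuous_fst.continuousOn : ContinuousOn (fun p : ℝ × ℝ => p.1) B)
  obtain ⟨⟨ht₁, hφ₁⟩, hle⟩ := hmem
  simp only [mem_preimage, mem_Iic] at ht₁ hφ₁ hle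
  have hm1 := hsubI ht₁
  have hgood : ∀ t ∈ Ico 0 t₁, ∀ φ, 0 < f t φ := by
    intro t ht φ
    by_contra! hh
    have htm : t ∈ Icc 0 tb := ⟨ht.1, ht.2.le.trans ht₁.2⟩
    obtain ⟨y, hy, h2⟩ := hfred t (hsubI htm) φ
    rw [h2] at hh
    have := hmin (show (t, y) ∈ B from ⟨⟨htm, hy⟩, hh⟩)
    simp only [mem_ofPred_eq] at this
    linarith [ht.2]
  have hY0 : Y 0 = X₀ := funext hsol.init
  have h0T : (0:ℝ) ∈ Ico 0 T := ⟨le_rfl, hm1.1.trans_lt hm1.2⟩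
  have hf0 : ∀ φ, 0 < f 0 φ := (hstarf 0 h0T).1 (by rw [hY0]; exact hstar₀)
  have ht₁pos : 0 < t₁ := by
    rcases hm1.1.lt_or_eq with h | h
    · exact h
    · rw [← h] at hle
      exact absurd (hf0 φ₁) (not_lt.2 hle)
  have hsub1 : Icc 0 t₁ ⊆ Ico 0 T := fun s hs => ⟨hs.1, hs.2.trans_lt hm1.2⟩
  have hstar1 : ∀ t ∈ Ico 0 t₁, StarShapedWrt (Y t) 0 := fun t ht =>
    (hstarf t (hsub1 (Ico_subset_Icc_self ht))).2 (hgood t ht)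
  have horig := csf_origin hsym₀ hsol hembt ht₁pos hm1.2 hstar1
  have hne : ∀ t ∈ Icc 0 t₁, ∀ φ, Y t φ ≠ 0 := by
    intro t ht φ
    rcases ht.2.lt_or_eq with h | h
    · intro h0
      have := hgood t ⟨ht.1, h⟩ φ
      simp [hf, h0, vdet] at this
    · rw [h]; exact horig φ
  have hnonneg : ∀ t ∈ Icc 0 t₁, ∀ φ, 0 ≤ f t φ := by
    intro t ht φ
    rcases ht.2.lt_or_eq with h | h
    · exact (hgood t ⟨ht.1, h⟩ φ).le
    · rw [h]
      have hUn : Tendsto (fun t : ℝ => t) (nhdsWithin t₁ (Iio t₁)) (nhds t₁) := nhdsWithin_le_nhds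
      have hev : ∀ᶠ t in nhdsWithin t₁ (Iio t₁), t ∈ Ico 0 t₁ := Ico_mem_nhdsLT ht₁pos
      have hcw := hfc (t₁, φ) ⟨hm1, mem_univ _⟩
      have hlim : Tendsto (fun t => f t φ) (nhdsWithin t₁ (Iio t₁)) (nhds (f t₁ φ)) := by
        refine Tendsto.comp (g := fun p : ℝ × ℝ => f p.1 p.2) hcw (f := fun t => (t, φ)) ?_
        refine tendsto_nhdsWithin_iff.2 ⟨hUn.prodMk_nhds tendsto_const_nhds, ?_⟩
        filter_upwards [hev] with s hs
        exact ⟨hsub1 (Ico_subset_Icc_self hs), mem_univ _⟩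
      refine ge_of_tendsto hlim ?_
      filter_upwards [hev] with s hs
      exact (hgood s hs φ).le
  -- lower bound for the distance to the origin
  obtain ⟨⟨tc, φc⟩, hcm, hcmin⟩ := (isCompact_Icc.prod isCompact_Icc).exists_isMinOn
    (s := Icc 0 t₁ ×ˢ Icc 0 (2 * π)) ⟨(0, 0), ⟨⟨le_rfl, ht₁pos.le⟩, ⟨le_rfl, hpi2⟩⟩⟩
    (vnorm_cont.comp_continuousOn (hcY.mono (Set.prod_mono hsub1 (subset_univ _))))
  set c := vnorm (Y tc φc) with hc
  have hcpos : 0 < c := vnorm_pos (hne tc hcm.1 φc)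
  have hcle : ∀ t ∈ Icc 0 t₁, ∀ φ ∈ Icc 0 (2 * π), c ≤ vnorm (Y t φ) := fun t ht φ hφ =>
    hcmin (show (t, φ) ∈ Icc 0 t₁ ×ˢ Icc 0 (2 * π) from ⟨ht, hφ⟩)
  have hf0c : ContinuousOn (f 0) (Icc 0 (2 * π)) :=
    hfc.comp (f := fun x : ℝ => ((0:ℝ), x)) (by fun_prop) (fun x _ => ⟨h0T, mem_univ _⟩)
  obtain ⟨φm, -, hφm⟩ := isCompact_Icc.exists_isMinOn ⟨0, le_rfl, hpi2⟩ hf0c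
  have hδpos : 0 < min c (f 0 φm) := lt_min hcpos (hf0 _)
  have key := csf_max_principle (Icc 0 (2 * π)) isCompact_Icc f t₁ (min c (f 0 φm))
    (hfc.mono (Set.prod_mono hsub1 (subset_univ _)))
    (fun x hx => (min_le_right _ _).trans (hφm hx))
    (by
      intro t ht x hx hxm hlt
      have htI : t ∈ Icc 0 t₁ := ⟨ht.1.le, ht.2⟩
      have htT : t ∈ Ioo 0 T := ⟨ht.1, ht.2.trans_lt hm1.2⟩
      have l0 := vnorm_pos ((hsol.curve t (hsub1 htI)).regular x)
      have hnn := hnonneg t htI x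
      refine csf_det_evolve hsol htT x ?_ ?_ ?_
      · have : vdet (Y t x) (deriv (Y t) x) = f t x * vnorm (deriv (Y t) x) := by
          simp only [hf]; field_simp
        rw [this]; positivity
      · intro hdot
        have h1 : f t x < vnorm (Y t x) :=
          (hlt.trans_le (min_le_left _ _)).trans_le (hcle t htI x hx)
        have h2 : vdet (Y t x) (deriv (Y t) x) = f t x * vnorm (deriv (Y t) x) := by
          simp only [hf]; field_simp
        have h3 : vdet (Y t x) (deriv (Y t) x) ^ 2 + vdot (Y t x) (deriv (Y t) x) ^ 2 =
            vnorm (Y t x) ^ 2 * vnorm (deriv (Y t) x) ^ 2 := by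
          rw [vnorm_sq, vnorm_sq]; simp only [vdet, vdot]; ring
        rw [hdot, h2] at h3
        have h4 : f t x ^ 2 < vnorm (Y t x) ^ 2 := by
          apply pow_lt_pow_left₀ h1 hnn (by norm_num)
        have h5 := mul_lt_mul_of_pos_right h4 (pow_pos l0 2)
        nlinarith
      · intro φ
        obtain ⟨y, hy, h2⟩ := hfred t (hsub1 htI) φ
        change f t x ≤ f t φ
        rw [h2]
        exact hxm y hy)
  have := key t₁ ⟨ht₁pos.le, le_rfl⟩ φ₁ hφ₁
  linarith
end
end
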